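/- arXiv:1103.4968 — 2 statements merged into one kernel-verified Lean document; each statement's English description precedes it below -/
import Mathlib

section
/- There exist a group Γ with a finite generating set S whose Cayley graph is G = Cay(Γ,S), and sequences (G_n) and (K_n) of finite graphs, both Benjamini–Schramm converging to G, such that: each K_n contains a Hamiltonian cycle C_n; the sequence of pairs (K_n, C_n) locally converges (for every r ∈ ℕ and every rooted edge-2-colored finite graph α, the proportion p_r(α; K_n, C_n) converges as n → ∞); and yet for every choice of subgraphs D_n ⊆ G_n, the sequence of pairs (G_n, D_n) does not converge to the same limit as (K_n, C_n), i.e., there exist r ∈ ℕ and a rooted edge-2-colored finite graph α such that p_r(α; G_n, D_n) does not converge to lim_n p_r(α; K_n, C_n). -/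
open Filter Topology SimpleGraph
open scoped Classical

/-- The Cayley graph of a group with respect to a set `S`:
`x` and `y` are adjacent iff `x⁻¹ * y ∈ S` or `y⁻¹ * x ∈ S` (and `x ≠ y`,
which is automatic when `1 ∉ S`). -/
def cayley {Γ : Type*} [Group Γ] (S : Set Γ) : SimpleGraph Γ :=
  SimpleGraph.fromRel (fun x y => x⁻¹ * y ∈ S)

/-- The set of vertices at graph distance at most `r` from `x`. -/
def ballSet {V : Type*} (G : SimpleGraph V) (x : V) (r : ℕ) : Set V :=
  {y | ∃ w : G.Walk x y, w.length ≤ r}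

lemma self_mem_ballSet {V : Type*} (G : SimpleGraph V) (x : V) (r : ℕ) :
    x ∈ ballSet G x r := ⟨SimpleGraph.Walk.nil, by simp⟩

/-- The rooted `r`-ball of `G` at `x` is rooted-isomorphic to the rooted `r`-ball
of `H` at `y`. -/
def RootedBallIso {V W : Type*} (G : SimpleGraph V) (x : V)
    (H : SimpleGraph W) (y : W) (r : ℕ) : Prop :=
  ∃ f : G.induce (ballSet G x r) ≃g H.induce (ballSet H y r),
    (f ⟨x, self_mem_ballSet G x r⟩).1 = y

/-- The proportion of vertices of a finite graph `G` whose rooted `r`-ball is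
rooted-isomorphic to the rooted `r`-ball of `H` at `y`. -/
noncomputable def ballIsoProportion {V W : Type*} [Fintype V] (G : SimpleGraph V)
    (H : SimpleGraph W) (y : W) (r : ℕ) : ℝ :=
  (Nat.card {x : V // RootedBallIso G x H y r} : ℝ) / (Fintype.card V : ℝ)

/-- Benjamini–Schramm convergence of a sequence of finite graphs to a fixed
(vertex-transitive) graph `H` rooted at `o`: for every `r`, the proportion of
vertices whose rooted `r`-ball is rooted-isomorphic to the `r`-ball of `H` at `o`
tends to `1`. -/
def BSLimit {V : ℕ → Type*} [∀ n, Fintype (V n)] (G : ∀ n, SimpleGraph (V n))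
    {W : Type*} (H : SimpleGraph W) (o : W) : Prop :=
  ∀ r : ℕ, Tendsto (fun n => ballIsoProportion (G n) H o r) atTop (𝓝 1)

/-- A rooted color-preserving isomorphism from the rooted `r`-ball of the pair
`(H, D)` at `x` (edges colored according to membership in the subgraph `D`) to the
rooted edge-2-colored finite graph given by `(A, B, w)` on `Fin m` (with `B` the
subgraph of `A` consisting of the edges of the distinguished color and root `w`). -/
def ColoredBallIso {V : Type*} {m : ℕ} (H D : SimpleGraph V) (x : V) (r : ℕ)
    (A B : SimpleGraph (Fin m)) (w : Fin m) : Prop :=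
  ∃ f : H.induce (ballSet H x r) ≃g A,
    f ⟨x, self_mem_ballSet H x r⟩ = w ∧
    ∀ u v : ballSet H x r, D.Adj u.1 v.1 ↔ B.Adj (f u) (f v)

/-- `p_r(α; H, D)`: the proportion of vertices `x` of the finite graph `H` whose
rooted `r`-ball, with each edge colored according to whether it belongs to `D`, is
isomorphic to the rooted edge-2-colored graph `α = (A, B, w)` by a rooted
isomorphism preserving edge colors. -/
noncomputable def coloredProportion {V : Type*} [Fintype V] (H D : SimpleGraph V)
    (r m : ℕ) (A B : SimpleGraph (Fin m)) (w : Fin m) : ℝ :=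
  (Nat.card {x : V // ColoredBallIso H D x r A B w} : ℝ) / (Fintype.card V : ℝ)

/-- The spanning subgraph of `K` consisting of the edges of the closed walk `c`. -/
def cycleSubgraph {V : Type*} (K : SimpleGraph V) {v : V} (c : K.Walk v v) :
    SimpleGraph V :=
  SimpleGraph.fromEdgeSet {e | e ∈ c.edges}

section SpectralGap

variable {Z : Type*} [Fintype Z]

lemma norm_sq_ge_of_sub (a b : ℂ) : 3 / 4 * ‖b‖ ^ 2 - 3 * ‖a - b‖ ^ 2 ≤ ‖a‖ ^ 2 := by
  have h : ‖b‖ ≤ ‖a‖ + ‖a - b‖ := by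
    have := norm_sub_le a (a - b)
    simpa using this
  have := norm_nonneg b
  nlinarith [sq_nonneg (‖a‖ - 3 * ‖a - b‖), norm_nonneg a, norm_nonneg (a - b),
    mul_le_mul h h this (by positivity)]

lemma sum_image_norm_sq_ge [DecidableEq Z] (F : Z → ℂ) (a : Equiv.Perm Z) (E : Finset Z) :
    3 / 4 * ∑ z ∈ E, ‖F z‖ ^ 2 - 3 * ∑ z, ‖F (a z) - F z‖ ^ 2 ≤
      ∑ z ∈ E.image a, ‖F z‖ ^ 2 := by
  rw [Finset.sum_image (fun x _ y _ h => a.injective h)]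
  have h1 : ∑ z ∈ E, ‖F (a z) - F z‖ ^ 2 ≤ ∑ z, ‖F (a z) - F z‖ ^ 2 :=
    Finset.sum_le_sum_of_subset_of_nonneg (Finset.subset_univ _) (fun _ _ _ => by positivity)
  have h2 : ∑ z ∈ E, (3 / 4 * ‖F z‖ ^ 2 - 3 * ‖F (a z) - F z‖ ^ 2) ≤ ∑ z ∈ E, ‖F (a z)‖ ^ 2 :=
    Finset.sum_le_sum (fun z _ => norm_sq_ge_of_sub _ _)
  rw [Finset.sum_sub_distrib, ← Finset.mul_sum, ← Finset.mul_sum] at h2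
  linarith

/-- If two permutations map `E` to disjoint subsets of `Q`, a function that is almost invariant
under both has little mass on `Q` unless much of it lies on `Q \ E`. -/
lemma mass_le_of_disjoint_images [DecidableEq Z] (F : Z → ℂ) (a b : Equiv.Perm Z) (E Q : Finset Z)
    (hE : E ⊆ Q) (ha : ∀ z ∈ E, a z ∈ Q) (hb : ∀ z ∈ E, b z ∈ Q)
    (hab : ∀ z ∈ E, ∀ z' ∈ E, a z ≠ b z') :
    ∑ z ∈ Q, ‖F z‖ ^ 2 ≤ 3 * ∑ z ∈ Q \ E, ‖F z‖ ^ 2 +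
      6 * (∑ z, ‖F (a z) - F z‖ ^ 2 + ∑ z, ‖F (b z) - F z‖ ^ 2) := by
  have h1 := sum_image_norm_sq_ge F a E
  have h2 := sum_image_norm_sq_ge F b E
  have hdisj : Disjoint (E.image a) (E.image b) := by
    rw [Finset.disjoint_left]
    simp only [Finset.mem_image, not_exists, not_and]
    rintro _ ⟨z, hz, rfl⟩ z' hz' h
    exact hab z hz z' hz' h.symm
  have h3 : ∑ z ∈ E.image a ∪ E.image b, ‖F z‖ ^ 2 ≤ ∑ z ∈ Q, ‖F z‖ ^ 2 := by
    refine Finset.sum_le_sum_of_subset_of_nonneg ?_ (fun _ _ _ => by positivity)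
    intro z
    simp only [Finset.mem_union, Finset.mem_image]
    rintro (⟨y, hy, rfl⟩ | ⟨y, hy, rfl⟩)
    exacts [ha y hy, hb y hy]
  rw [Finset.sum_union hdisj] at h3
  have h4 := Finset.sum_sdiff (f := fun z => ‖F z‖ ^ 2) hE
  linarith

variable {p : ℕ}

/-- The shear `(x, y) ↦ (x + y, y)`. -/
def shearU (p : ℕ) : Equiv.Perm (ZMod p × ZMod p) where
  toFun z := (z.1 + z.2, z.2)
  invFun z := (z.1 - z.2, z.2)
  left_inv z := by simp
  right_inv z := by simp

/-- The shear `(x, y) ↦ (x, x + y)`. -/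
def shearL (p : ℕ) : Equiv.Perm (ZMod p × ZMod p) where
  toFun z := (z.1, z.1 + z.2)
  invFun z := (z.1, z.2 - z.1)
  left_inv z := by simp
  right_inv z := by simp

/-- The translation `(x, y) ↦ (x + 1, y)`. -/
def translX (p : ℕ) : Equiv.Perm (ZMod p × ZMod p) where
  toFun z := (z.1 + 1, z.2)
  invFun z := (z.1 - 1, z.2)
  left_inv z := by simp
  right_inv z := by simp

/-- The translation `(x, y) ↦ (x, y + 1)`. -/
def translY (p : ℕ) : Equiv.Perm (ZMod p × ZMod p) where
  toFun z := (z.1, z.2 + 1)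
  invFun z := (z.1, z.2 - 1)
  left_inv z := by simp
  right_inv z := by simp

lemma sum_perm_symm_sub (F : Z → ℂ) (a : Equiv.Perm Z) :
    ∑ z, ‖F (a.symm z) - F z‖ ^ 2 = ∑ z, ‖F (a z) - F z‖ ^ 2 := by
  rw [← Equiv.sum_comp a]
  simp [norm_sub_rev]

/-- A representative has absolute value less than a quarter of the modulus. -/
def IsSmall {p : ℕ} (a : ZMod p) : Prop := 4 * |a.valMinAbs| < p

lemma valMinAbs_add_of_isSmall [NeZero p] {a b : ZMod p} (ha : IsSmall a) (hb : IsSmall b) :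
    (a + b).valMinAbs = a.valMinAbs + b.valMinAbs := by
  rw [ZMod.valMinAbs_spec]
  refine ⟨by simp, ?_⟩
  unfold IsSmall at ha hb
  have h1 := abs_lt.1 (show |a.valMinAbs| < |a.valMinAbs| + 1 by linarith)
  constructor <;> grind

lemma valMinAbs_sub_of_isSmall [NeZero p] {a b : ZMod p} (ha : IsSmall a) (hb : IsSmall b) :
    (a - b).valMinAbs = a.valMinAbs - b.valMinAbs := by
  rw [ZMod.valMinAbs_spec]
  refine ⟨by simp, ?_⟩
  unfold IsSmall at ha hb
  constructor <;> grind

/-- A function vanishing at the origin and almost invariant under both shears has most of its mass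
outside the central box. -/
lemma mass_le_of_shears [NeZero p] (F : ZMod p × ZMod p → ℂ) (h0 : F 0 = 0) :
    ∑ z, ‖F z‖ ^ 2 ≤
      3 * ∑ z with ¬ (IsSmall z.1 ∧ IsSmall z.2), ‖F z‖ ^ 2 +
      12 * (∑ z, ‖F (shearU p z) - F z‖ ^ 2 + ∑ z, ‖F (shearL p z) - F z‖ ^ 2) := by
  let Q₁ : Finset (ZMod p × ZMod p) := Finset.univ.filter fun z =>
    (0 < z.1.valMinAbs ∧ 0 ≤ z.2.valMinAbs) ∨ (z.1.valMinAbs < 0 ∧ z.2.valMinAbs ≤ 0)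
  let Q₂ : Finset (ZMod p × ZMod p) := Finset.univ.filter fun z =>
    (z.1.valMinAbs ≤ 0 ∧ 0 < z.2.valMinAbs) ∨ (0 ≤ z.1.valMinAbs ∧ z.2.valMinAbs < 0)
  let B : Finset (ZMod p × ZMod p) := Finset.univ.filter fun z => IsSmall z.1 ∧ IsSmall z.2
  have hQ : Disjoint Q₁ Q₂ := by
    rw [Finset.disjoint_left]
    intro z
    simp only [Q₁, Q₂, Finset.mem_filter, Finset.mem_univ, true_and]
    omega
  have h1 := mass_le_of_disjoint_images F (shearU p) (shearL p) (Q₁ ∩ B) Q₁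
    Finset.inter_subset_left
    (by
      intro z
      simp only [Q₁, B, Finset.mem_inter, Finset.mem_filter, Finset.mem_univ, true_and, shearU,
        Equiv.coe_fn_mk]
      rintro ⟨h, hs, ht⟩
      rw [valMinAbs_add_of_isSmall hs ht]
      omega)
    (by
      intro z
      simp only [Q₁, B, Finset.mem_inter, Finset.mem_filter, Finset.mem_univ, true_and, shearL,
        Equiv.coe_fn_mk]
      rintro ⟨h, hs, ht⟩
      rw [valMinAbs_add_of_isSmall hs ht]
      omega)
    (by
      intro z hz z' hz' h
      simp only [Q₁, B, Finset.mem_inter, Finset.mem_filter, Finset.mem_univ, true_and] at hz hz'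
      obtain ⟨h₁, hs, ht⟩ := hz
      obtain ⟨h₂, hs', ht'⟩ := hz'
      simp only [shearU, shearL, Equiv.coe_fn_mk, Prod.mk.injEq] at h
      have e1 := congrArg ZMod.valMinAbs h.1
      have e2 := congrArg ZMod.valMinAbs h.2
      rw [valMinAbs_add_of_isSmall hs ht] at e1
      rw [valMinAbs_add_of_isSmall hs' ht'] at e2
      omega)
  have h2 := mass_le_of_disjoint_images F (shearU p).symm (shearL p).symm (Q₂ ∩ B) Q₂
    Finset.inter_subset_left
    (by
      intro z
      simp only [Q₂, B, Finset.mem_inter, Finset.mem_filter, Finset.mem_univ, true_and, shearU,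
        Equiv.coe_fn_symm_mk]
      rintro ⟨h, hs, ht⟩
      rw [valMinAbs_sub_of_isSmall hs ht]
      omega)
    (by
      intro z
      simp only [Q₂, B, Finset.mem_inter, Finset.mem_filter, Finset.mem_univ, true_and, shearL,
        Equiv.coe_fn_symm_mk]
      rintro ⟨h, hs, ht⟩
      rw [valMinAbs_sub_of_isSmall ht hs]
      omega)
    (by
      intro z hz z' hz' h
      simp only [Q₂, B, Finset.mem_inter, Finset.mem_filter, Finset.mem_univ, true_and] at hz hz'
      obtain ⟨h₁, hs, ht⟩ := hz
      obtain ⟨h₂, hs', ht'⟩ := hz'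
      simp only [shearU, shearL, Equiv.coe_fn_symm_mk, Prod.mk.injEq] at h
      have e1 := congrArg ZMod.valMinAbs h.1
      have e2 := congrArg ZMod.valMinAbs h.2
      rw [valMinAbs_sub_of_isSmall hs ht] at e1
      rw [valMinAbs_sub_of_isSmall ht' hs'] at e2
      omega)
  rw [sum_perm_symm_sub, sum_perm_symm_sub] at h2
  have h3 : ∑ z, ‖F z‖ ^ 2 = ∑ z ∈ Q₁, ‖F z‖ ^ 2 + ∑ z ∈ Q₂, ‖F z‖ ^ 2 := by
    rw [← Finset.sum_union hQ]
    symm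
    refine Finset.sum_subset (Finset.subset_univ _) ?_
    intro z _ hz
    have : z = 0 := by
      simp only [Q₁, Q₂, Finset.mem_union, Finset.mem_filter, Finset.mem_univ, true_and] at hz
      ext
      · rw [Prod.fst_zero, ← ZMod.valMinAbs_eq_zero]; omega
      · rw [Prod.snd_zero, ← ZMod.valMinAbs_eq_zero]; omega
    simp [this, h0]
  have h4 : ∑ z ∈ Q₁ \ (Q₁ ∩ B), ‖F z‖ ^ 2 + ∑ z ∈ Q₂ \ (Q₂ ∩ B), ‖F z‖ ^ 2 ≤
      ∑ z with ¬ (IsSmall z.1 ∧ IsSmall z.2), ‖F z‖ ^ 2 := by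
    rw [← Finset.sum_union
      (hQ.mono Finset.sdiff_subset Finset.sdiff_subset)]
    refine Finset.sum_le_sum_of_subset_of_nonneg ?_ (fun _ _ _ => by positivity)
    intro z
    simp only [B, Finset.mem_union, Finset.mem_sdiff, Finset.mem_inter, Finset.mem_filter,
      Finset.mem_univ, true_and]
    tauto
  linarith

/-- The discrete Fourier transform on `(ℤ/p)²`, without normalization. -/
noncomputable def planeDFT [NeZero p] (f : ZMod p × ZMod p → ℂ) (z : ZMod p × ZMod p) : ℂ :=
  ∑ x, f x * ZMod.stdAddChar (x.1 * z.1 + x.2 * z.2)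

lemma sum_stdAddChar_plane [NeZero p] (a b : ZMod p) :
    ∑ z : ZMod p × ZMod p, (ZMod.stdAddChar (a * z.1 + b * z.2) : ℂ) =
      if a = 0 ∧ b = 0 then (p : ℂ) ^ 2 else 0 := by
  have h : ∀ c : ZMod p, ∑ t : ZMod p, (ZMod.stdAddChar (c * t) : ℂ) =
      if c = 0 then (p : ℂ) else 0 := by
    intro c
    have := AddChar.sum_mulShift c (ZMod.isPrimitive_stdAddChar p)
    simp only [mul_comm c, this, ZMod.card]
    split_ifs <;> simp
  rw [Fintype.sum_prod_type]
  simp only [AddChar.map_add_eq_mul, ← Finset.mul_sum, ← Finset.sum_mul, h]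
  split_ifs <;> simp_all [sq]

lemma sum_norm_sq_planeDFT [NeZero p] (f : ZMod p × ZMod p → ℂ) :
    ∑ z, ‖planeDFT f z‖ ^ 2 = (p : ℝ) ^ 2 * ∑ x, ‖f x‖ ^ 2 := by
  have key : ∑ z, planeDFT f z * (starRingEnd ℂ) (planeDFT f z) =
      (p : ℂ) ^ 2 * ∑ x, f x * (starRingEnd ℂ) (f x) := by
    have h1 : ∀ z, planeDFT f z * (starRingEnd ℂ) (planeDFT f z) =
        ∑ x, ∑ y, f x * (starRingEnd ℂ) (f y) *
          ZMod.stdAddChar ((x.1 - y.1) * z.1 + (x.2 - y.2) * z.2) := by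
      intro z
      rw [planeDFT, map_sum, Finset.sum_mul_sum]
      refine Finset.sum_congr rfl fun x _ => Finset.sum_congr rfl fun y _ => ?_
      rw [map_mul, ← AddChar.map_neg_eq_conj, mul_mul_mul_comm, ← AddChar.map_add_eq_mul]
      congr 2
      ring
    simp only [h1]
    rw [Finset.sum_comm, Finset.mul_sum]
    refine Finset.sum_congr rfl fun x _ => ?_
    rw [Finset.sum_comm]
    simp only [← Finset.mul_sum, sum_stdAddChar_plane]
    rw [Finset.sum_eq_single x]
    · simp [mul_comm]
    · intro y _ hy
      rw [if_neg, mul_zero]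
      rintro ⟨h, h'⟩
      exact hy (Prod.ext (sub_eq_zero.1 h).symm (sub_eq_zero.1 h').symm)
    · simp
  simp only [Complex.mul_conj, Complex.normSq_eq_norm_sq] at key
  exact_mod_cast key

lemma planeDFT_sub [NeZero p] (f g : ZMod p × ZMod p → ℂ) (z : ZMod p × ZMod p) :
    planeDFT (fun x => f x - g x) z = planeDFT f z - planeDFT g z := by
  simp [planeDFT, sub_mul]

lemma planeDFT_shearU [NeZero p] (f : ZMod p × ZMod p → ℂ) (z : ZMod p × ZMod p) :
    planeDFT (fun x => f (shearU p x)) z = planeDFT f ((shearL p).symm z) := by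
  rw [planeDFT, planeDFT]
  conv_rhs => rw [← Equiv.sum_comp (shearU p)]
  refine Finset.sum_congr rfl fun x _ => ?_
  simp only [shearU, shearL, Equiv.coe_fn_mk, Equiv.coe_fn_symm_mk]
  congr 2
  ring

lemma planeDFT_shearL [NeZero p] (f : ZMod p × ZMod p → ℂ) (z : ZMod p × ZMod p) :
    planeDFT (fun x => f (shearL p x)) z = planeDFT f ((shearU p).symm z) := by
  rw [planeDFT, planeDFT]
  conv_rhs => rw [← Equiv.sum_comp (shearL p)]
  refine Finset.sum_congr rfl fun x _ => ?_
  simp only [shearU, shearL, Equiv.coe_fn_mk, Equiv.coe_fn_symm_mk]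
  congr 2
  ring

lemma planeDFT_translX [NeZero p] (f : ZMod p × ZMod p → ℂ) (z : ZMod p × ZMod p) :
    planeDFT f z = ZMod.stdAddChar z.1 * planeDFT (fun x => f (translX p x)) z := by
  rw [planeDFT, planeDFT, ← Equiv.sum_comp (translX p), Finset.mul_sum]
  refine Finset.sum_congr rfl fun x _ => ?_
  simp only [translX, Equiv.coe_fn_mk]
  rw [mul_left_comm, ← AddChar.map_add_eq_mul]
  congr 2
  ring

lemma planeDFT_translY [NeZero p] (f : ZMod p × ZMod p → ℂ) (z : ZMod p × ZMod p) :
    planeDFT f z = ZMod.stdAddChar z.2 * planeDFT (fun x => f (translY p x)) z := by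
  rw [planeDFT, planeDFT, ← Equiv.sum_comp (translY p), Finset.mul_sum]
  refine Finset.sum_congr rfl fun x _ => ?_
  simp only [translY, Equiv.coe_fn_mk]
  rw [mul_left_comm, ← AddChar.map_add_eq_mul]
  congr 2
  ring

lemma re_stdAddChar_nonpos [NeZero p] {a : ZMod p} (ha : ¬ IsSmall a) :
    (ZMod.stdAddChar a : ℂ).re ≤ 0 := by
  have hp : (0 : ℝ) < p := by exact_mod_cast NeZero.pos p
  have hb : |a.valMinAbs| * 2 ≤ p := by
    have := ZMod.valMinAbs_mem_Ioc a
    rw [Set.mem_Ioc] at this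
    rcases abs_cases a.valMinAbs with h | h <;> (rw [h.1]; omega)
  have ha' : (p : ℤ) ≤ 4 * |a.valMinAbs| := not_lt.1 ha
  have hb' : |(a.valMinAbs : ℝ)| * 2 ≤ p := by exact_mod_cast hb
  have ha'' : (p : ℝ) ≤ 4 * |(a.valMinAbs : ℝ)| := by exact_mod_cast ha'
  have h1 : (ZMod.stdAddChar a : ℂ).re = Real.cos (2 * Real.pi * a.valMinAbs / p) := by
    conv_lhs => rw [← ZMod.coe_valMinAbs a, ZMod.stdAddChar_coe]
    rw [show (2 * Real.pi * Complex.I * (a.valMinAbs : ℂ) / p : ℂ) =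
      ((2 * Real.pi * a.valMinAbs / p : ℝ) : ℂ) * Complex.I by push_cast; ring]
    exact Complex.exp_ofReal_mul_I_re _
  rw [h1, ← Real.cos_abs, abs_div, abs_mul, abs_of_pos hp, abs_of_pos Real.two_pi_pos]
  have hpi := Real.pi_pos
  apply Real.cos_nonpos_of_pi_div_two_le_of_le
  · rw [le_div_iff₀ hp]
    nlinarith
  · rw [div_le_iff₀ hp]
    nlinarith

lemma norm_sq_stdAddChar_mul_sub [NeZero p] {a : ZMod p} (ha : ¬ IsSmall a) (w : ℂ) :
    ‖ZMod.stdAddChar a * w‖ ^ 2 ≤ ‖w - ZMod.stdAddChar a * w‖ ^ 2 := by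
  have h := re_stdAddChar_nonpos ha
  rw [show w - ZMod.stdAddChar a * w = (1 - ZMod.stdAddChar a) * w by ring, norm_mul, norm_mul,
    AddChar.norm_apply, one_mul, mul_pow]
  have h1 : 1 ≤ ‖(1 : ℂ) - ZMod.stdAddChar a‖ := by
    refine le_trans ?_ (Complex.re_le_norm _)
    simpa using h
  nlinarith [sq_nonneg ‖w‖, one_le_pow₀ h1 (n := 2)]

/-- The Poincaré inequality (spectral gap) for the action of the shears and translations on
`(ℤ/p)²`. -/
lemma sum_norm_sq_le_of_sum_eq_zero [NeZero p] (f : ZMod p × ZMod p → ℂ) (hf : ∑ x, f x = 0) :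
    ∑ x, ‖f x‖ ^ 2 ≤
      3 * (∑ x, ‖f (translX p x) - f x‖ ^ 2 + ∑ x, ‖f (translY p x) - f x‖ ^ 2) +
      12 * (∑ x, ‖f (shearU p x) - f x‖ ^ 2 + ∑ x, ‖f (shearL p x) - f x‖ ^ 2) := by
  have hp : (0 : ℝ) < (p : ℝ) ^ 2 := by have := NeZero.pos p; positivity
  have hU := sum_norm_sq_planeDFT (fun x => f (shearU p x) - f x)
  have hL := sum_norm_sq_planeDFT (fun x => f (shearL p x) - f x)
  have hX := sum_norm_sq_planeDFT (fun x => f (translX p x) - f x)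
  have hY := sum_norm_sq_planeDFT (fun x => f (translY p x) - f x)
  have hf2 := sum_norm_sq_planeDFT f
  simp only [planeDFT_sub (fun x => f (shearU p x)), planeDFT_shearU, sum_perm_symm_sub] at hU
  simp only [planeDFT_sub (fun x => f (shearL p x)), planeDFT_shearL, sum_perm_symm_sub] at hL
  have h0 : planeDFT f 0 = 0 := by simpa [planeDFT] using hf
  have main := mass_le_of_shears (planeDFT f) h0
  have hout : ∑ z with ¬ (IsSmall z.1 ∧ IsSmall z.2), ‖planeDFT f z‖ ^ 2 ≤
      ∑ z, ‖planeDFT (fun x => f (translX p x) - f x) z‖ ^ 2 +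
      ∑ z, ‖planeDFT (fun x => f (translY p x) - f x) z‖ ^ 2 := by
    rw [← Finset.sum_add_distrib]
    refine le_trans (Finset.sum_le_sum fun z hz => ?_)
      (Finset.sum_le_sum_of_subset_of_nonneg (Finset.subset_univ _)
        fun _ _ _ => by positivity)
    simp only [Finset.mem_filter, Finset.mem_univ, true_and, not_and_or] at hz
    rw [planeDFT_sub (fun x => f (translX p x)), planeDFT_sub (fun x => f (translY p x))]
    rcases hz with hz | hz
    · have := norm_sq_stdAddChar_mul_sub hz (planeDFT (fun x => f (translX p x)) z)
      rw [← planeDFT_translX] at this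
      exact this.trans (le_add_of_nonneg_right (by positivity))
    · have := norm_sq_stdAddChar_mul_sub hz (planeDFT (fun x => f (translY p x)) z)
      rw [← planeDFT_translY] at this
      exact this.trans (le_add_of_nonneg_left (by positivity))
  rw [hX, hY] at hout
  rw [hf2, hU, hL] at main
  refine le_of_mul_le_mul_left ?_ hp
  linarith

/-- The number of points of a set leaving it under a permutation. -/
noncomputable def leaving {Z : Type*} [Fintype Z] (X : Set Z) (a : Equiv.Perm Z) : ℝ :=
  (Nat.card {x : Z // x ∈ X ∧ a x ∉ X} : ℝ)

lemma sum_indicator_comp_sub {Z : Type*} [Fintype Z] (X : Set Z) (a : Equiv.Perm Z) (μ : ℂ) :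
    ∑ x, ‖(Set.indicator X 1 (a x) - μ) - (Set.indicator X (1 : Z → ℂ) x - μ)‖ ^ 2 =
      2 * leaving X a := by
  have h1 : ∀ x, ‖(Set.indicator X 1 (a x) - μ) - (Set.indicator X (1 : Z → ℂ) x - μ)‖ ^ 2 =
      2 * (if x ∈ X ∧ a x ∉ X then (1 : ℝ) else 0) +
        ((if a x ∈ X then 1 else 0) - (if x ∈ X then 1 else 0)) := by
    intro x
    rw [sub_sub_sub_cancel_right]
    by_cases hx : x ∈ X <;> by_cases hax : a x ∈ X <;> simp [hx, hax]
    norm_num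
  simp only [h1, Finset.sum_add_distrib, Finset.sum_sub_distrib, ← Finset.mul_sum]
  rw [Equiv.sum_comp a (fun x => if x ∈ X then (1 : ℝ) else 0), sub_self, add_zero]
  congr 1
  rw [leaving, Nat.card_eq_fintype_card, Fintype.card_subtype]
  simp

/-- Isoperimetric inequality for the action of the shears and translations on `(ℤ/p)²`. -/
lemma card_mul_card_compl_le [NeZero p] (X : Set (ZMod p × ZMod p)) :
    (Nat.card {x // x ∈ X} : ℝ) * ((p : ℝ) ^ 2 - Nat.card {x // x ∈ X}) ≤
      24 * (p : ℝ) ^ 2 * (leaving X (translX p) + leaving X (translY p) +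
        leaving X (shearU p) + leaving X (shearL p)) := by
  have hp : (0 : ℝ) < (p : ℝ) ^ 2 := by have := NeZero.pos p; positivity
  set k : ℝ := (Nat.card {x // x ∈ X} : ℝ) with hk
  set μ : ℝ := k / (p : ℝ) ^ 2 with hμ
  have hksum : ∑ x, (if x ∈ X then (1 : ℝ) else 0) = k := by
    rw [hk, Nat.card_eq_fintype_card, Fintype.card_subtype]
    simp
  have hcard : ∑ _x : ZMod p × ZMod p, (1 : ℝ) = (p : ℝ) ^ 2 := by
    simp [ZMod.card, sq]
  have hreal : ∀ x, Set.indicator X (1 : ZMod p × ZMod p → ℂ) x - (μ : ℂ) =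
      (((if x ∈ X then (1 : ℝ) else 0) - μ * 1 : ℝ) : ℂ) := by
    intro x
    by_cases hx : x ∈ X <;> simp [hx]
  have h0 : ∑ x, (Set.indicator X (1 : ZMod p × ZMod p → ℂ) x - (μ : ℂ)) = 0 := by
    simp only [hreal, ← Complex.ofReal_sum]
    rw [Finset.sum_sub_distrib, ← Finset.mul_sum, hksum, hcard, hμ, div_mul_cancel₀ _ hp.ne',
      sub_self, Complex.ofReal_zero]
  have h1 : ∑ x, ‖Set.indicator X (1 : ZMod p × ZMod p → ℂ) x - (μ : ℂ)‖ ^ 2 =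
      k - k ^ 2 / (p : ℝ) ^ 2 := by
    have : ∀ x, ‖Set.indicator X (1 : ZMod p × ZMod p → ℂ) x - (μ : ℂ)‖ ^ 2 =
        (1 - 2 * μ) * (if x ∈ X then (1 : ℝ) else 0) + μ ^ 2 * 1 := by
      intro x
      rw [hreal, Complex.norm_real, Real.norm_eq_abs, sq_abs]
      by_cases hx : x ∈ X <;> simp [hx]; ring
    simp only [this]
    rw [Finset.sum_add_distrib, ← Finset.mul_sum, ← Finset.mul_sum, hksum, hcard, hμ]
    field_simp
    ring
  have key := sum_norm_sq_le_of_sum_eq_zero _ h0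
  simp only [sum_indicator_comp_sub, h1] at key
  have hn : ∀ a, 0 ≤ leaving X a := fun a => Nat.cast_nonneg _
  have h2 : k * ((p : ℝ) ^ 2 - k) = (p : ℝ) ^ 2 * (k - k ^ 2 / (p : ℝ) ^ 2) := by
    rw [mul_sub, mul_sub, mul_div_cancel₀ _ hp.ne']
    ring
  rw [h2, mul_comm (24 : ℝ), mul_assoc]
  refine mul_le_mul_of_nonneg_left (key.trans ?_) hp.le
  linarith [hn (translX p), hn (translY p)]

end SpectralGap

section ColoredIso

variable {U V W : Type*}

lemma mem_ballSet_zero {G : SimpleGraph V} {x y : V} : y ∈ ballSet G x 0 ↔ y = x := by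
  constructor
  · rintro ⟨w, hw⟩
    exact (SimpleGraph.Walk.eq_of_length_eq_zero (Nat.le_zero.1 hw)).symm
  · rintro rfl
    exact self_mem_ballSet _ _ _

lemma ballSet_mono (G : SimpleGraph V) (x : V) {r s : ℕ} (h : r ≤ s) :
    ballSet G x r ⊆ ballSet G x s :=
  fun _ ⟨w, hw⟩ => ⟨w, hw.trans h⟩

lemma mem_ballSet_succ_of_adj {G : SimpleGraph V} {x y z : V} {r : ℕ} (hy : y ∈ ballSet G x r)
    (h : G.Adj y z) : z ∈ ballSet G x (r + 1) := by
  obtain ⟨w, hw⟩ := hy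
  exact ⟨w.concat h, by simpa using hw⟩

lemma exists_adj_of_mem_ballSet_succ {G : SimpleGraph V} {x z : V} {r : ℕ}
    (hz : z ∈ ballSet G x (r + 1)) : z = x ∨ ∃ y ∈ ballSet G x r, G.Adj y z := by
  obtain ⟨w, hw⟩ := hz
  rcases eq_or_ne z x with h | h
  · exact Or.inl h
  · right
    have hn : ¬ w.Nil := SimpleGraph.Walk.not_nil_of_ne h.symm
    refine ⟨_, ⟨w.dropLast, ?_⟩, w.adj_penultimate hn⟩
    have := w.length_dropLast_add_one hn
    omega

/-- The rooted `r`-balls of two edge-2-colored graphs are isomorphic. -/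
def ColoredIso (H D : SimpleGraph V) (x : V) (H' D' : SimpleGraph W) (o : W) (r : ℕ) : Prop :=
  ∃ f : H.induce (ballSet H x r) ≃g H'.induce (ballSet H' o r),
    f ⟨x, self_mem_ballSet H x r⟩ = ⟨o, self_mem_ballSet H' o r⟩ ∧
    ∀ u v : ballSet H x r, D.Adj u.1 v.1 ↔ D'.Adj (f u).1 (f v).1

lemma ColoredIso.rootedBallIso {H D : SimpleGraph V} {x : V} {H' D' : SimpleGraph W} {o : W}
    {r : ℕ} (h : ColoredIso H D x H' D' o r) : RootedBallIso H x H' o r := by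
  obtain ⟨f, hf, -⟩ := h
  exact ⟨f, by rw [hf]⟩

lemma ColoredIso.symm {H D : SimpleGraph V} {x : V} {H' D' : SimpleGraph W} {o : W}
    {r : ℕ} (h : ColoredIso H D x H' D' o r) : ColoredIso H' D' o H D x r := by
  obtain ⟨f, hf, hD⟩ := h
  refine ⟨f.symm, by rw [← hf]; exact f.symm_apply_apply _, fun u v => ?_⟩
  rw [hD]
  have h1 : ∀ z, f (f.symm z) = z := f.apply_symm_apply
  rw [h1, h1]

lemma ColoredIso.coloredBallIso {H D : SimpleGraph V} {x : V} {H' D' : SimpleGraph W} {o : W}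
    {r m : ℕ} {A B : SimpleGraph (Fin m)} {w : Fin m} (h : ColoredIso H D x H' D' o r)
    (h' : ColoredBallIso H' D' o r A B w) : ColoredBallIso H D x r A B w := by
  obtain ⟨f, hf, hD⟩ := h
  obtain ⟨g, hg, hB⟩ := h'
  exact ⟨f.trans g, by simp [hf, hg], fun u v => by rw [hD, hB]; rfl⟩

lemma ColoredIso.coloredBallIso_iff {H D : SimpleGraph V} {x : V} {H' D' : SimpleGraph W} {o : W}
    {r m : ℕ} {A B : SimpleGraph (Fin m)} {w : Fin m} (h : ColoredIso H D x H' D' o r) :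
    ColoredBallIso H D x r A B w ↔ ColoredBallIso H' D' o r A B w :=
  ⟨h.symm.coloredBallIso, h.coloredBallIso⟩

lemma ColoredBallIso.coloredIso {H D : SimpleGraph V} {x : V} {H' D' : SimpleGraph W} {o : W}
    {r m : ℕ} {A B : SimpleGraph (Fin m)} {w : Fin m} (h : ColoredBallIso H D x r A B w)
    (h' : ColoredBallIso H' D' o r A B w) : ColoredIso H D x H' D' o r := by
  obtain ⟨f, hf, hD⟩ := h
  obtain ⟨g, hg, hB⟩ := h'
  have h1 : ∀ z, g (g.symm z) = z := g.apply_symm_apply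
  refine ⟨f.trans g.symm, ?_, fun u v => ?_⟩
  · change g.symm (f _) = _
    rw [hf, ← hg]
    exact g.symm_apply_apply _
  · change _ ↔ D'.Adj (g.symm (f u)).1 (g.symm (f v)).1
    rw [hD, hB, h1, h1]

lemma exists_coloredBallIso_of_finite (H D : SimpleGraph V) (x : V) (r : ℕ)
    (hfin : (ballSet H x r).Finite) :
    ∃ (m : ℕ) (A B : SimpleGraph (Fin m)) (w : Fin m), ColoredBallIso H D x r A B w := by
  have : Finite (ballSet H x r) := hfin
  obtain ⟨m, ⟨e⟩⟩ := Finite.exists_equiv_fin (ballSet H x r)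
  refine ⟨m, (H.induce _).map e.toEmbedding, (D.induce _).map e.toEmbedding,
    e ⟨x, self_mem_ballSet H x r⟩, SimpleGraph.Iso.map e _, rfl, fun u v => ?_⟩
  have := (SimpleGraph.Iso.map e (D.induce (ballSet H x r))).map_adj_iff (v := u) (w := v)
  exact this.symm

/-- A map of the `r`-ball of `o` that is injective, respects adjacency and colors and lifts edges
yields an isomorphism of colored rooted balls. -/
lemma coloredIso_of_map {H D : SimpleGraph V} {H' D' : SimpleGraph W} {o : W} {r : ℕ}
    (φ : W → V) (hinj : Set.InjOn φ (ballSet H' o r))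
    (hadj : ∀ g ∈ ballSet H' o r, ∀ h ∈ ballSet H' o r, H.Adj (φ g) (φ h) ↔ H'.Adj g h)
    (hcol : ∀ g ∈ ballSet H' o r, ∀ h ∈ ballSet H' o r, D.Adj (φ g) (φ h) ↔ D'.Adj g h)
    (hlift : ∀ g ∈ ballSet H' o r, ∀ v, H.Adj (φ g) v → ∃ h, H'.Adj g h ∧ φ h = v) :
    ColoredIso H D (φ o) H' D' o r := by
  have himage : ∀ k ≤ r, φ '' ballSet H' o k = ballSet H (φ o) k := by
    intro k
    induction k with
    | zero =>
      intro _
      ext v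
      simp only [Set.mem_image, mem_ballSet_zero]
      constructor
      · rintro ⟨_, rfl, rfl⟩; rfl
      · rintro rfl; exact ⟨o, rfl, rfl⟩
    | succ k ih =>
      intro hk
      have ih := ih (by omega)
      ext v
      constructor
      · rintro ⟨h, hh, rfl⟩
        rcases exists_adj_of_mem_ballSet_succ hh with rfl | ⟨g, hg, hgh⟩
        · exact self_mem_ballSet _ _ _
        · refine mem_ballSet_succ_of_adj (ih ▸ Set.mem_image_of_mem φ hg) ?_
          exact (hadj g (ballSet_mono _ _ (by omega) hg) h (ballSet_mono _ _ hk hh)).2 hgh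
      · intro hv
        rcases exists_adj_of_mem_ballSet_succ hv with rfl | ⟨u, hu, huv⟩
        · exact ⟨o, self_mem_ballSet _ _ _, rfl⟩
        · rw [← ih] at hu
          obtain ⟨g, hg, rfl⟩ := hu
          obtain ⟨h, hgh, rfl⟩ := hlift g (ballSet_mono _ _ (by omega) hg) v huv
          exact ⟨h, mem_ballSet_succ_of_adj hg hgh, rfl⟩
  have hbij : Set.BijOn φ (ballSet H' o r) (ballSet H (φ o) r) := by
    rw [← himage r le_rfl]
    exact hinj.bijOn_image
  refine ColoredIso.symm ⟨⟨hbij.equiv, ?_⟩, rfl, ?_⟩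
  · rintro ⟨g, hg⟩ ⟨h, hh⟩
    exact hadj g hg h hh
  · rintro ⟨g, hg⟩ ⟨h, hh⟩
    exact (hcol g hg h hh).symm

end ColoredIso

section Schreier

variable {Γ X V : Type*} [Group Γ]

/-- The Schreier graph of an action with respect to a set of group elements. -/
def schreier (ρ : Γ →* Equiv.Perm X) (T : Set Γ) : SimpleGraph X :=
  SimpleGraph.fromRel fun x y => ∃ s ∈ T, ρ s x = y

lemma cayley_adj_mul_inv {S : Set Γ} (h1 : (1 : Γ) ∉ S) (g : Γ) {s : Γ} (hs : s ∈ S) :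
    (cayley S).Adj g (g * s⁻¹) := by
  rw [cayley, SimpleGraph.fromRel_adj]
  refine ⟨fun h => h1 ?_, Or.inr (by simpa using hs)⟩
  have : s = 1 := by simpa using h
  exact this ▸ hs

lemma cayley_adj_mul {S : Set Γ} (h1 : (1 : Γ) ∉ S) (g : Γ) {s : Γ} (hs : s ∈ S) :
    (cayley S).Adj g (g * s) := by
  rw [cayley, SimpleGraph.fromRel_adj]
  refine ⟨fun h => h1 ?_, Or.inl (by simpa using hs)⟩
  have : s = 1 := by simpa using h
  exact this ▸ hs

lemma finite_ballSet_cayley {S : Set Γ} (hS : S.Finite) (x : Γ) (r : ℕ) :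
    (ballSet (cayley S) x r).Finite := by
  induction r with
  | zero =>
    refine (Set.finite_singleton x).subset fun y hy => ?_
    simpa using mem_ballSet_zero.1 hy
  | succ r ih =>
    refine ((Set.finite_singleton x).union
      ((Set.Finite.image2 (fun g s => g * s) ih hS).union
        (Set.Finite.image2 (fun g s => g * s⁻¹) ih hS))).subset fun z hz => ?_
    rcases exists_adj_of_mem_ballSet_succ hz with rfl | ⟨y, hy, hyz⟩
    · exact Or.inl rfl
    · rw [cayley, SimpleGraph.fromRel_adj] at hyz
      rcases hyz.2 with h | h
      · exact Or.inr (Or.inl ⟨y, hy, _, h, by simp⟩)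
      · exact Or.inr (Or.inr ⟨y, hy, _, h, by simp⟩)

/-- The point `x` has an orbit map injective on the `r`-ball of the Cayley graph, and the image of
this ball avoids `E`. -/
def IsGoodPoint (ρ : Γ →* Equiv.Perm X) (S : Set Γ) (E : Set X) (r : ℕ) (x : X) : Prop :=
  (∀ g ∈ ballSet (cayley S) 1 r, ∀ h ∈ ballSet (cayley S) 1 r, ρ g⁻¹ x = ρ h⁻¹ x → g = h) ∧
  ∀ g ∈ ballSet (cayley S) 1 r, ρ g⁻¹ x ∉ E

lemma schreier_adj_orbit_iff {ρ : Γ →* Equiv.Perm X} {S T : Set Γ} {E : Set X} {r : ℕ} {x : X}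
    (h1 : (1 : Γ) ∉ S) (hT : T ⊆ S) (hx : IsGoodPoint ρ S E (r + 1) x) {g h : Γ}
    (hg : g ∈ ballSet (cayley S) 1 r) (hh : h ∈ ballSet (cayley S) 1 r) :
    (schreier ρ T).Adj (ρ g⁻¹ x) (ρ h⁻¹ x) ↔ (cayley T).Adj g h := by
  have hg' := ballSet_mono (cayley S) 1 (Nat.le_succ r) hg
  have hh' := ballSet_mono (cayley S) 1 (Nat.le_succ r) hh
  have hne : ρ g⁻¹ x ≠ ρ h⁻¹ x ↔ g ≠ h :=
    not_congr ⟨hx.1 g hg' h hh', fun e => by rw [e]⟩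
  have key : ∀ {a b : Γ}, a ∈ ballSet (cayley S) 1 r → b ∈ ballSet (cayley S) 1 r →
      ((∃ s ∈ T, ρ s (ρ a⁻¹ x) = ρ b⁻¹ x) ↔ b⁻¹ * a ∈ T) := by
    intro a b ha hb
    constructor
    · rintro ⟨s, hs, e⟩
      have h2 := mem_ballSet_succ_of_adj ha (cayley_adj_mul_inv h1 a (hT hs))
      have h3 : ρ (a * s⁻¹)⁻¹ x = ρ b⁻¹ x := by
        rw [← e, mul_inv_rev, inv_inv, map_mul]; rfl
      rw [← hx.1 _ h2 b (ballSet_mono (cayley S) 1 (Nat.le_succ r) hb) h3]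
      simpa using hs
    · intro hs
      refine ⟨_, hs, ?_⟩
      rw [← Equiv.Perm.mul_apply, ← map_mul]
      simp
  rw [schreier, cayley, SimpleGraph.fromRel_adj, SimpleGraph.fromRel_adj, hne, key hg hh,
    key hh hg, or_comm]

/-- Around a good point, a graph modelled on the Schreier graph away from `E` looks like the
Cayley graph. -/
lemma coloredIso_of_isGoodPoint {ρ : Γ →* Equiv.Perm X} {S T : Set Γ} {E : Set X} {r : ℕ} {x : X}
    (h1 : (1 : Γ) ∉ S) (hT : T ⊆ S) (hx : IsGoodPoint ρ S E (r + 1) x)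
    {H D : SimpleGraph V} (ι : X → V) (hι : Function.Injective ι)
    (hH : ∀ z ∉ E, ∀ v, H.Adj (ι z) v ↔ ∃ z', v = ι z' ∧ (schreier ρ S).Adj z z')
    (hD : ∀ z ∉ E, ∀ v, D.Adj (ι z) v ↔ ∃ z', v = ι z' ∧ (schreier ρ T).Adj z z') :
    ColoredIso H D (ι x) (cayley S) (cayley T) 1 r := by
  have hE : ∀ g ∈ ballSet (cayley S) 1 r, ρ g⁻¹ x ∉ E :=
    fun g hg => hx.2 g (ballSet_mono (cayley S) 1 (Nat.le_succ r) hg)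
  have := coloredIso_of_map (H := H) (D := D) (H' := cayley S) (D' := cayley T) (o := 1) (r := r)
    (fun g => ι (ρ g⁻¹ x)) ?_ ?_ ?_ ?_
  · simpa using this
  · intro g hg h hh e
    exact hx.1 g (ballSet_mono (cayley S) 1 (Nat.le_succ r) hg) h
      (ballSet_mono (cayley S) 1 (Nat.le_succ r) hh) (hι e)
  · intro g hg h hh
    rw [hH _ (hE g hg), ← schreier_adj_orbit_iff h1 subset_rfl hx hg hh]
    constructor
    · rintro ⟨z', e, hz⟩
      rwa [hι e]
    · exact fun hz => ⟨_, rfl, hz⟩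
  · intro g hg h hh
    rw [hD _ (hE g hg), ← schreier_adj_orbit_iff h1 hT hx hg hh]
    constructor
    · rintro ⟨z', e, hz⟩
      rwa [hι e]
    · exact fun hz => ⟨_, rfl, hz⟩
  · intro g hg v hv
    rw [hH _ (hE g hg)] at hv
    obtain ⟨z', rfl, hz⟩ := hv
    rw [schreier, SimpleGraph.fromRel_adj] at hz
    rcases hz.2 with ⟨s, hs, e⟩ | ⟨s, hs, e⟩
    · refine ⟨g * s⁻¹, cayley_adj_mul_inv h1 g hs, ?_⟩
      simp [← e]
    · refine ⟨g * s, cayley_adj_mul h1 g hs, ?_⟩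
      have e' : (ρ g)⁻¹ x = ρ s z' := by rw [e, map_inv]
      simp only [mul_inv_rev, map_mul, map_inv, Equiv.Perm.mul_apply, e']
      simp

end Schreier

section Density

/-- A sequence of subsets of finite sets has density tending to zero. -/
def Negligible {X : ℕ → Type*} [∀ n, Fintype (X n)] (N : ∀ n, Set (X n)) : Prop :=
  Tendsto (fun n => ((N n).ncard : ℝ) / Fintype.card (X n)) atTop (𝓝 0)

variable {X : ℕ → Type*} [∀ n, Fintype (X n)]

lemma Negligible.mono {M N : ∀ n, Set (X n)} (hN : Negligible N) (h : ∀ n, M n ⊆ N n) :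
    Negligible M := by
  refine squeeze_zero (fun n => by positivity) (fun n => ?_) hN
  have := Set.ncard_le_ncard (h n) (Set.toFinite _)
  gcongr

lemma Negligible.union {M N : ∀ n, Set (X n)} (hM : Negligible M) (hN : Negligible N) :
    Negligible fun n => M n ∪ N n := by
  unfold Negligible at hM hN
  have h := hM.add hN
  rw [add_zero] at h
  refine squeeze_zero (fun n => by positivity) (fun n => ?_) h
  rw [← add_div]
  have := Set.ncard_union_le (M n) (N n)
  gcongr
  exact_mod_cast this

lemma negligible_empty : Negligible fun n => (∅ : Set (X n)) := by
  simp [Negligible]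

lemma negligible_biUnion {ι : Type*} {s : Set ι} (hs : s.Finite) {N : ι → ∀ n, Set (X n)}
    (h : ∀ i ∈ s, Negligible (N i)) : Negligible fun n => ⋃ i ∈ s, N i n := by
  induction s, hs using Set.Finite.induction_on with
  | empty => simpa using negligible_empty
  | insert _ _ ih =>
    simp only [Set.biUnion_insert]
    exact (h _ (Set.mem_insert _ _)).union (ih fun i hi => h i (Set.mem_insert_of_mem _ hi))

lemma Negligible.preimage {N : ∀ n, Set (X n)} (hN : Negligible N)
    (e : ∀ n, Equiv.Perm (X n)) : Negligible fun n => e n ⁻¹' N n := by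
  have : ∀ n, (e n ⁻¹' N n).ncard = (N n).ncard := fun n =>
    Set.ncard_preimage_of_injective_subset_range (e n).injective
      (by simp [(e n).surjective.range_eq])
  simpa [Negligible, this] using hN

lemma tendsto_proportion [∀ n, Nonempty (X n)] {P : ∀ n, X n → Prop} {c : Prop}
    (h : Negligible fun n => {x | ¬ (P n x ↔ c)}) :
    Tendsto (fun n => (Nat.card {x // P n x} : ℝ) / Fintype.card (X n)) atTop
      (𝓝 (if c then 1 else 0)) := by
  by_cases hc : c
  · simp only [hc, iff_true, if_true] at h ⊢
    unfold Negligible at h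
    have h2 := h.const_sub 1
    rw [sub_zero] at h2
    refine h2.congr fun n => ?_
    have h3 : (Fintype.card (X n) : ℝ) ≠ 0 := by exact_mod_cast Fintype.card_ne_zero
    have h4 := Set.ncard_add_ncard_compl {x | P n x}
    rw [Nat.card_eq_fintype_card] at h4
    rw [eq_div_iff h3, sub_mul, div_mul_cancel₀ _ h3, one_mul, ← h4]
    have h5 : Nat.card {x // P n x} = {x | P n x}.ncard := rfl
    have h6 : {x | ¬ P n x} = {x | P n x}ᶜ := rfl
    simp only [h5, h6]
    push_cast
    ring
  · simp only [hc, iff_false, not_not, if_false] at h ⊢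
    exact h

variable {Γ : Type*} [Group Γ]

lemma negligible_not_isGoodPoint {ρ : ∀ n, Γ →* Equiv.Perm (X n)} {S : Set Γ} (hS : S.Finite)
    (hfix : ∀ k : Γ, k ≠ 1 → Negligible fun n => {x | ρ n k x = x})
    {E : ∀ n, Set (X n)} (hE : Negligible E) (r : ℕ) :
    Negligible fun n => {x | ¬ IsGoodPoint (ρ n) S (E n) r x} := by
  have hB := finite_ballSet_cayley hS 1 r
  have h1 : Negligible fun n => ⋃ q ∈ {q : Γ × Γ | q ∈ (ballSet (cayley S) 1 r) ×ˢ
      (ballSet (cayley S) 1 r) ∧ q.1 ≠ q.2}, {x : X n | ρ n (q.2 * q.1⁻¹) x = x} := by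
    refine negligible_biUnion ((hB.prod hB).subset fun q hq => hq.1) fun q hq => hfix _ ?_
    intro h
    exact hq.2 (mul_inv_eq_one.1 h).symm
  have h2 : Negligible fun n => ⋃ g ∈ ballSet (cayley S) 1 r, (ρ n g⁻¹) ⁻¹' (E n) :=
    negligible_biUnion hB fun g _ => hE.preimage _
  refine (h1.union h2).mono fun n x hx => ?_
  by_contra hcon
  simp only [Set.mem_union, Set.mem_iUnion, not_or, not_exists] at hcon
  refine hx ⟨fun g hg h hh e => ?_, fun g hg => hcon.2 g hg⟩
  by_contra hne
  refine hcon.1 (g, h) ⟨⟨hg, hh⟩, hne⟩ ?_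
  simp only [Set.mem_ofPred_eq, map_mul, Equiv.Perm.mul_apply, e]
  simp

end Density

section Limits

variable {X : ℕ → Type*} [∀ n, Fintype (X n)] [∀ n, Nonempty (X n)]

lemma tendsto_proportion_bool_prod {P : ∀ n, Bool × X n → Prop} {c : Bool → Prop}
    (h : ∀ i, Negligible fun n => {x | ¬ (P n (i, x) ↔ c i)}) :
    Tendsto (fun n => (Nat.card {v // P n v} : ℝ) / Fintype.card (Bool × X n)) atTop
      (𝓝 (((if c false then 1 else 0) + (if c true then 1 else 0)) / 2)) := by
  refine (((tendsto_proportion (h false)).add (tendsto_proportion (h true))).div_const 2).congr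
    fun n => ?_
  have h1 : Nat.card {v // P n v} =
      Nat.card {x // P n (false, x)} + Nat.card {x // P n (true, x)} := by
    simp only [Nat.card_eq_fintype_card, Fintype.card_subtype, Finset.card_filter]
    rw [Fintype.sum_prod_type, Fintype.sum_bool, add_comm]
  have h3 : (Fintype.card (X n) : ℝ) ≠ 0 := by exact_mod_cast Fintype.card_ne_zero
  rw [h1, Fintype.card_prod, Fintype.card_bool]
  push_cast
  field_simp

variable {Γ : Type*} [Group Γ] {ρ : ∀ n, Γ →* Equiv.Perm (X n)} {S : Set Γ}

lemma bsLimit_schreier (hS : S.Finite) (h1 : (1 : Γ) ∉ S)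
    (hfix : ∀ k : Γ, k ≠ 1 → Negligible fun n => {x | ρ n k x = x}) :
    BSLimit (fun n => schreier (ρ n) S) (cayley S) 1 := by
  intro r
  have h := tendsto_proportion (X := X) (c := True)
    (P := fun n x => RootedBallIso (schreier (ρ n) S) x (cayley S) 1 r)
    ((negligible_not_isGoodPoint hS hfix negligible_empty (r + 1)).mono fun n x hx => by
      intro hgood
      exact hx (iff_true_intro (coloredIso_of_isGoodPoint h1 subset_rfl hgood id
        Function.injective_id (H := schreier (ρ n) S) (by simp) (D := schreier (ρ n) S)
        (by simp)).rootedBallIso))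
  simpa [ballIsoProportion] using h

variable {t : Bool → Γ} {E : Bool → ∀ n, Set (X n)} {K C : ∀ n, SimpleGraph (Bool × X n)}

lemma tendsto_coloredProportion (hS : S.Finite) (h1 : (1 : Γ) ∉ S)
    (hfix : ∀ k : Γ, k ≠ 1 → Negligible fun n => {x | ρ n k x = x})
    (ht : ∀ i, t i ∈ S) (hE : ∀ i, Negligible (E i))
    (hK : ∀ n i, ∀ z ∉ E i n, ∀ v, (K n).Adj (i, z) v ↔
      ∃ z', v = (i, z') ∧ (schreier (ρ n) S).Adj z z')
    (hC : ∀ n i, ∀ z ∉ E i n, ∀ v, (C n).Adj (i, z) v ↔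
      ∃ z', v = (i, z') ∧ (schreier (ρ n) {t i}).Adj z z')
    (r m : ℕ) (A B : SimpleGraph (Fin m)) (w : Fin m) :
    Tendsto (fun n => coloredProportion (K n) (C n) r m A B w) atTop
      (𝓝 (((if ColoredBallIso (cayley S) (cayley {t false}) 1 r A B w then 1 else 0) +
        (if ColoredBallIso (cayley S) (cayley {t true}) 1 r A B w then 1 else 0)) / 2)) := by
  refine tendsto_proportion_bool_prod
    (c := fun i => ColoredBallIso (cayley S) (cayley {t i}) 1 r A B w) fun i => ?_
  refine (negligible_not_isGoodPoint hS hfix (hE i) (r + 1)).mono fun n x hx => ?_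
  intro hgood
  exact hx (coloredIso_of_isGoodPoint h1 (Set.singleton_subset_iff.2 (ht i)) hgood (Prod.mk i)
    (Prod.mk_right_injective i) (hK n i) (hC n i)).coloredBallIso_iff

lemma bsLimit_of_local_model (hS : S.Finite) (h1 : (1 : Γ) ∉ S)
    (hfix : ∀ k : Γ, k ≠ 1 → Negligible fun n => {x | ρ n k x = x})
    (hE : ∀ i, Negligible (E i))
    (hK : ∀ n i, ∀ z ∉ E i n, ∀ v, (K n).Adj (i, z) v ↔
      ∃ z', v = (i, z') ∧ (schreier (ρ n) S).Adj z z') :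
    BSLimit K (cayley S) 1 := by
  intro r
  have h := tendsto_proportion_bool_prod (X := X) (c := fun _ => True)
    (P := fun n v => RootedBallIso (K n) v (cayley S) 1 r) fun i => by
      refine (negligible_not_isGoodPoint hS hfix (hE i) (r + 1)).mono fun n x hx => ?_
      intro hgood
      exact hx (iff_true_intro (coloredIso_of_isGoodPoint h1 subset_rfl hgood (Prod.mk i)
        (Prod.mk_right_injective i) (hK n i) (D := K n) (hK n i)).rootedBallIso)
  simpa [ballIsoProportion] using h

end Limits

section Triangles

variable {V W : Type*}

/-- Any two distinct neighbors of `y` in `D` are adjacent in `H`. -/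
def NeighborsAdjacent (H D : SimpleGraph V) (y : V) : Prop :=
  ∀ u v, D.Adj y u → D.Adj y v → u ≠ v → H.Adj u v

lemma ColoredIso.exists_neighborsAdjacent {H D : SimpleGraph V} {x : V} {H' D' : SimpleGraph W}
    {o : W} (h : ColoredIso H D x H' D' o 2) (hD : D ≤ H) {y : V} (hy : y ∈ ballSet H x 1) :
    ∃ z, (y = x → z = o) ∧ (NeighborsAdjacent H' D' z → NeighborsAdjacent H D y) := by
  obtain ⟨f, hf, hcol⟩ := h
  have hy2 : y ∈ ballSet H x 2 := ballSet_mono H x (by norm_num) hy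
  refine ⟨(f ⟨y, hy2⟩).1, ?_, ?_⟩
  · rintro rfl
    rw [hf]
  · intro hz u v hu hv huv
    have hu2 : u ∈ ballSet H x 2 := mem_ballSet_succ_of_adj hy (hD hu)
    have hv2 : v ∈ ballSet H x 2 := mem_ballSet_succ_of_adj hy (hD hv)
    have h1 := (hcol ⟨y, hy2⟩ ⟨u, hu2⟩).1 hu
    have h2 := (hcol ⟨y, hy2⟩ ⟨v, hv2⟩).1 hv
    have h3 := hz _ _ h1 h2 (fun e => huv (congrArg Subtype.val (f.injective (Subtype.ext e))))
    exact f.map_adj_iff.1 h3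

variable {X Γ : Type*} [Group Γ]

/-- If the two colored ball types are told apart by `NeighborsAdjacent`, few points of the first
type leave it under a generator. -/
lemma leaving_le [Fintype X] {ρ : Γ →* Equiv.Perm X} {S : Set Γ} {t₀ t₁ : Γ}
    (ht₁ : t₁ ∈ S)
    (h₀ : ∀ z, NeighborsAdjacent (cayley S) (cayley {t₀}) z)
    (h₁ : ¬ NeighborsAdjacent (cayley S) (cayley {t₁}) 1)
    {m₀ m₁ : ℕ} {A₀ B₀ : SimpleGraph (Fin m₀)} {w₀ : Fin m₀} {A₁ B₁ : SimpleGraph (Fin m₁)}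
    {w₁ : Fin m₁}
    (hα₀ : ColoredBallIso (cayley S) (cayley {t₀}) 1 2 A₀ B₀ w₀)
    (hα₁ : ColoredBallIso (cayley S) (cayley {t₁}) 1 2 A₁ B₁ w₁)
    {D : SimpleGraph X} (hD : D ≤ schreier ρ S) {s : Γ} (hs : s ∈ S) :
    leaving {x | ColoredBallIso (schreier ρ S) D x 2 A₀ B₀ w₀} (ρ s) ≤
      Fintype.card X - Nat.card {x // ColoredBallIso (schreier ρ S) D x 2 A₀ B₀ w₀} -
        Nat.card {x // ColoredBallIso (schreier ρ S) D x 2 A₁ B₁ w₁} := by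
  set P : Set X := {x | ColoredBallIso (schreier ρ S) D x 2 A₀ B₀ w₀} with hP
  set Q : Set X := {x | ColoredBallIso (schreier ρ S) D x 2 A₁ B₁ w₁} with hQ
  have hC : cayley {t₁} ≤ cayley S := by
    intro a b hab
    rw [cayley, SimpleGraph.fromRel_adj] at hab ⊢
    refine ⟨hab.1, hab.2.imp ?_ ?_⟩ <;> · rintro rfl; exact ht₁
  have hP' : ∀ x ∈ P, ∀ y ∈ ballSet (schreier ρ S) x 1, NeighborsAdjacent (schreier ρ S) D y := by
    intro x hx y hy
    obtain ⟨z, -, hz⟩ := (ColoredBallIso.coloredIso hx hα₀).exists_neighborsAdjacent hD hy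
    exact hz (h₀ z)
  have hQ' : ∀ x ∈ Q, ¬ NeighborsAdjacent (schreier ρ S) D x := by
    intro x hx hn
    obtain ⟨z, hz, hz'⟩ := (ColoredBallIso.coloredIso hα₁ hx).exists_neighborsAdjacent hC
      (self_mem_ballSet _ _ _)
    rw [hz rfl] at hz'
    exact h₁ (hz' hn)
  have hdisj : Disjoint P Q := by
    rw [Set.disjoint_left]
    exact fun x hx hx' => hQ' x hx' (hP' x hx x (self_mem_ballSet _ _ _))
  have hsub : ρ s '' {x | x ∈ P ∧ ρ s x ∉ P} ⊆ (P ∪ Q)ᶜ := by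
    rintro _ ⟨x, ⟨hx, hsx⟩, rfl⟩
    rintro (h | h)
    · exact hsx h
    · refine hQ' _ h (hP' x hx _ ?_)
      refine mem_ballSet_succ_of_adj (self_mem_ballSet _ _ _) ?_
      rw [schreier, SimpleGraph.fromRel_adj]
      exact ⟨fun e => hsx (e ▸ hx), Or.inl ⟨s, hs, rfl⟩⟩
  have h1 := Set.ncard_le_ncard hsub (Set.toFinite _)
  rw [Set.ncard_image_of_injective _ (ρ s).injective] at h1
  have h2 := Set.ncard_add_ncard_compl (P ∪ Q)
  rw [Set.ncard_union_eq hdisj, Nat.card_eq_fintype_card] at h2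
  have h3 : leaving P (ρ s) = ({x | x ∈ P ∧ ρ s x ∉ P}.ncard : ℝ) := rfl
  change _ ≤ (Fintype.card X : ℝ) - (P.ncard : ℝ) - (Q.ncard : ℝ)
  rw [h3, ← h2]
  push_cast
  have : ({x | x ∈ P ∧ ρ s x ∉ P}.ncard : ℝ) ≤ ((P ∪ Q)ᶜ.ncard : ℝ) := by exact_mod_cast h1
  linarith

end Triangles

section HamiltonianCycle

variable {V : Type*}

lemma exists_walk_of_seq {H : SimpleGraph V} (w : ℕ → V) (M : ℕ)
    (hadj : ∀ k < M, H.Adj (w k) (w (k + 1))) :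
    ∃ q : H.Walk (w 0) (w M), q.length = M ∧ q.support = (List.range (M + 1)).map w ∧
      q.edges = (List.range M).map fun k => s(w k, w (k + 1)) := by
  induction M with
  | zero => exact ⟨SimpleGraph.Walk.nil, by simp⟩
  | succ M ih =>
    obtain ⟨q, hl, hs, he⟩ := ih fun k hk => hadj k (by omega)
    refine ⟨q.concat (hadj M (by omega)), by simp [hl], ?_, ?_⟩
    · rw [SimpleGraph.Walk.support_concat, hs, List.range_succ (n := M + 1)]
      simp
    · rw [SimpleGraph.Walk.edges_concat, he, List.range_succ (n := M)]
      simp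

/-- `v` follows `u` in the cyclic order `w 0, …, w M`. -/
def CyclicNext (w : ℕ → V) (M : ℕ) (u v : V) : Prop :=
  (∃ k < M, u = w k ∧ v = w (k + 1)) ∨ (u = w M ∧ v = w 0)

lemma CyclicNext.unique_left {w : ℕ → V} {M : ℕ} (hinj : ∀ i ≤ M, ∀ j ≤ M, w i = w j → i = j)
    {u u' v : V} (h : CyclicNext w M u v) (h' : CyclicNext w M u' v) : u = u' := by
  rcases h with ⟨k, hk, rfl, rfl⟩ | ⟨rfl, rfl⟩ <;> rcases h' with ⟨l, hl, rfl, e⟩ | ⟨rfl, e⟩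
  · have := hinj _ hk _ hl e
    rw [Nat.succ_injective this]
  · exact absurd (hinj _ hk _ (Nat.zero_le _) e) (by simp)
  · exact absurd (hinj _ (Nat.zero_le _) _ hl e) (by simp)
  · rfl

lemma exists_hamiltonianCycle [Fintype V] [DecidableEq V] {H : SimpleGraph V} {M : ℕ}
    (hM : 2 ≤ M) (w : ℕ → V) (hinj : ∀ i ≤ M, ∀ j ≤ M, w i = w j → i = j)
    (hcard : Fintype.card V = M + 1) (hH : SimpleGraph.fromRel (CyclicNext w M) ≤ H) :
    ∃ c : H.Walk (w M) (w M), c.IsHamiltonianCycle ∧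
      cycleSubgraph H c = SimpleGraph.fromRel (CyclicNext w M) := by
  have hadj : ∀ k < M, H.Adj (w k) (w (k + 1)) := by
    intro k hk
    refine hH ((SimpleGraph.fromRel_adj _ _ _).2 ⟨fun e => ?_, Or.inl (Or.inl ⟨k, hk, rfl, rfl⟩)⟩)
    exact absurd (hinj _ hk.le _ hk e) (by simp)
  have hlast : H.Adj (w M) (w 0) := by
    refine hH ((SimpleGraph.fromRel_adj _ _ _).2 ⟨fun e => ?_, Or.inl (Or.inr ⟨rfl, rfl⟩)⟩)
    have := hinj _ le_rfl _ (Nat.zero_le _) e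
    omega
  obtain ⟨q, hl, hs, he⟩ := exists_walk_of_seq w M hadj
  refine ⟨SimpleGraph.Walk.cons hlast q, ?_, ?_⟩
  · rw [SimpleGraph.Walk.isHamiltonianCycle_iff_isCycle_and_length_eq,
      SimpleGraph.Walk.cons_isCycle_iff]
    refine ⟨⟨?_, ?_⟩, by simp [hl, hcard]⟩
    · rw [SimpleGraph.Walk.isPath_def, hs]
      refine List.Nodup.map_on ?_ List.nodup_range
      intro i hi j hj e
      rw [List.mem_range] at hi hj
      exact hinj i (by omega) j (by omega) e
    · rw [he]
      simp only [List.mem_map, List.mem_range, not_exists, not_and]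
      intro k hk e
      rw [Sym2.eq_iff] at e
      rcases e with ⟨e, -⟩ | ⟨e, e'⟩
      · have := hinj _ hk.le _ le_rfl e
        omega
      · have h1 := hinj _ hk.le _ (Nat.zero_le _) e
        have h2 := hinj _ hk _ le_rfl e'
        omega
  · ext u v
    rw [cycleSubgraph, SimpleGraph.fromEdgeSet_adj, SimpleGraph.fromRel_adj, and_comm]
    refine and_congr_right fun _ => ?_
    simp only [Set.mem_ofPred_eq, SimpleGraph.Walk.edges_cons, he, List.mem_cons, List.mem_map,
      List.mem_range, Sym2.eq_iff, CyclicNext]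
    constructor
    · rintro ((⟨rfl, rfl⟩ | ⟨rfl, rfl⟩) | ⟨k, hk, (⟨rfl, rfl⟩ | ⟨rfl, rfl⟩)⟩)
      · exact Or.inl (Or.inr ⟨rfl, rfl⟩)
      · exact Or.inr (Or.inr ⟨rfl, rfl⟩)
      · exact Or.inl (Or.inl ⟨k, hk, rfl, rfl⟩)
      · exact Or.inr (Or.inl ⟨k, hk, rfl, rfl⟩)
    · rintro ((⟨k, hk, rfl, rfl⟩ | ⟨rfl, rfl⟩) | (⟨k, hk, rfl, rfl⟩ | ⟨rfl, rfl⟩))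
      · exact Or.inr ⟨k, hk, Or.inl ⟨rfl, rfl⟩⟩
      · exact Or.inl (Or.inl ⟨rfl, rfl⟩)
      · exact Or.inr ⟨k, hk, Or.inr ⟨rfl, rfl⟩⟩
      · exact Or.inl (Or.inr ⟨rfl, rfl⟩)

/-- Two disjoint copies of a graph. -/
def twoCopies (G : SimpleGraph V) : SimpleGraph (Bool × V) where
  Adj u v := u.1 = v.1 ∧ G.Adj u.2 v.2
  symm := ⟨fun _ _ h => ⟨h.1.symm, h.2.symm⟩⟩
  loopless := ⟨fun _ h => G.loopless.irrefl _ h.2⟩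

end HamiltonianCycle

section Snake

variable {p : ℕ}

/-- The translation along the lines followed in the given copy of the plane. -/
def lineShift (p : ℕ) : Bool → Equiv.Perm (ZMod p × ZMod p)
  | false => translX p
  | true => translY p

/-- The coordinate along the lines followed in the given copy of the plane. -/
def lineCoord : Bool → ZMod p × ZMod p → ZMod p
  | false => Prod.fst
  | true => Prod.snd

/-- Enumeration of two copies of `(ℤ/p)²`: horizontal lines in the first copy, then vertical lines
in the second one. -/
def snake (p k : ℕ) : Bool × (ZMod p × ZMod p) :=
  if k < p ^ 2 then (false, ((k : ZMod p), ((k / p : ℕ) : ZMod p)))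
  else (true, ((((k - p ^ 2) / p : ℕ) : ZMod p), (k : ZMod p)))

lemma snake_surjective [NeZero p] (v : Bool × (ZMod p × ZMod p)) :
    ∃ k ≤ 2 * p ^ 2 - 1, snake p k = v := by
  have hp := NeZero.pos p
  have hval : ∀ a b : ZMod p, a.val * p + b.val < p ^ 2 := by
    intro a b
    have h1 := ZMod.val_lt a
    have h2 := ZMod.val_lt b
    nlinarith [Nat.mul_le_mul_right p (Nat.succ_le_of_lt h1)]
  have hdiv : ∀ a b : ZMod p, (a.val * p + b.val) / p = a.val := by
    intro a b
    rw [mul_comm, Nat.mul_add_div hp, Nat.div_eq_of_lt (ZMod.val_lt b), add_zero]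
  obtain ⟨_ | _, x, y⟩ := v
  · refine ⟨y.val * p + x.val, by have := hval y x; omega, ?_⟩
    rw [snake, if_pos (hval y x), hdiv]
    simp
  · refine ⟨p ^ 2 + (x.val * p + y.val), by have := hval x y; omega, ?_⟩
    rw [snake, if_neg (by omega), Nat.add_sub_cancel_left, hdiv]
    simp

lemma snake_injective [NeZero p] (i : ℕ) (hi : i ≤ 2 * p ^ 2 - 1) (j : ℕ)
    (hj : j ≤ 2 * p ^ 2 - 1) (h : snake p i = snake p j) : i = j := by
  have hp : 0 < p ^ 2 := pow_pos (NeZero.pos p) 2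
  let f : Fin (2 * p ^ 2) → Bool × (ZMod p × ZMod p) := fun k => snake p k
  have hf : Function.Bijective f := by
    rw [Fintype.bijective_iff_surjective_and_card]
    refine ⟨fun v => ?_, by simp [ZMod.card, sq]⟩
    obtain ⟨k, hk, e⟩ := snake_surjective v
    exact ⟨⟨k, by omega⟩, e⟩
  have := hf.injective (a₁ := ⟨i, by omega⟩) (a₂ := ⟨j, by omega⟩) h
  simpa using this

lemma snake_succ [NeZero p] {k : ℕ} (hk : k ≤ 2 * p ^ 2 - 1) {i : Bool} {z : ZMod p × ZMod p}
    (h : snake p k = (i, z)) (hz : lineCoord i z ≠ -1) :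
    k < 2 * p ^ 2 - 1 ∧ snake p (k + 1) = (i, lineShift p i z) := by
  have hp : 0 < p ^ 2 := pow_pos (NeZero.pos p) 2
  have hdvd : ¬ p ∣ k + 1 := by
    intro hd
    rw [← ZMod.natCast_eq_zero_iff] at hd
    apply hz
    rw [eq_neg_iff_add_eq_zero, ← hd]
    rw [snake] at h
    split_ifs at h <;> obtain ⟨rfl, rfl⟩ := Prod.mk.inj h <;> simp [lineCoord]
  have hne : ∀ c, k + 1 ≠ c * p ^ 2 := fun c e => hdvd (e ▸ ⟨c * p, by ring⟩)
  have h1 := hne 1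
  have h2 := hne 2
  refine ⟨by omega, ?_⟩
  rw [snake] at h
  split_ifs at h with hlt
  · obtain ⟨rfl, rfl⟩ := Prod.mk.inj h
    rw [snake, if_pos (by omega), Nat.succ_div_of_not_dvd hdvd]
    simp [lineShift, translX]
  · obtain ⟨rfl, rfl⟩ := Prod.mk.inj h
    have hd : ¬ p ∣ k - p ^ 2 + 1 := by
      rw [← Nat.sub_add_comm (by omega)]
      intro hd
      exact hdvd ((Nat.dvd_sub_iff_left (by omega) (dvd_pow_self p two_ne_zero)).1 hd)
    rw [snake, if_neg (by omega), Nat.sub_add_comm (by omega), Nat.succ_div_of_not_dvd hd]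
    simp [lineShift, translY]

lemma cyclicNext_snake_iff [NeZero p] {i : Bool} {z : ZMod p × ZMod p} (hz : lineCoord i z ≠ -1)
    (v : Bool × (ZMod p × ZMod p)) :
    CyclicNext (snake p) (2 * p ^ 2 - 1) (i, z) v ↔ v = (i, lineShift p i z) := by
  constructor
  · rintro (⟨k, hk, h, rfl⟩ | ⟨h, rfl⟩)
    · exact (snake_succ hk.le h.symm hz).2
    · exact absurd (snake_succ le_rfl h.symm hz).1 (lt_irrefl _)
  · rintro rfl
    obtain ⟨k, hk, e⟩ := snake_surjective (i, z)
    obtain ⟨h1, h2⟩ := snake_succ hk e hz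
    exact Or.inl ⟨k, h1, e.symm, h2.symm⟩

lemma cyclicNext_snake_iff' [NeZero p] {i : Bool} {z : ZMod p × ZMod p} (hz : lineCoord i z ≠ 0)
    (v : Bool × (ZMod p × ZMod p)) :
    CyclicNext (snake p) (2 * p ^ 2 - 1) v (i, z) ↔ v = (i, (lineShift p i).symm z) := by
  have hz' : lineCoord i ((lineShift p i).symm z) ≠ -1 := by
    intro h
    apply hz
    cases i <;> simpa [lineCoord, lineShift, translX, translY, sub_eq_iff_eq_add] using h
  have h := (cyclicNext_snake_iff hz' (i, z)).2 (by simp)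
  exact ⟨fun h' => h'.unique_left snake_injective h, fun e => e ▸ h⟩

lemma fromRel_cyclicNext_adj_iff [NeZero p] {Γ : Type*} [Group Γ]
    {ρ : Γ →* Equiv.Perm (ZMod p × ZMod p)} {i : Bool} {t : Γ} (ht : ρ t = lineShift p i)
    {z : ZMod p × ZMod p} (hz : lineCoord i z ≠ 0 ∧ lineCoord i z ≠ -1)
    (v : Bool × (ZMod p × ZMod p)) :
    (SimpleGraph.fromRel (CyclicNext (snake p) (2 * p ^ 2 - 1))).Adj (i, z) v ↔
      ∃ z', v = (i, z') ∧ (schreier ρ {t}).Adj z z' := by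
  rw [SimpleGraph.fromRel_adj, cyclicNext_snake_iff hz.2, cyclicNext_snake_iff' hz.1]
  simp only [schreier, SimpleGraph.fromRel_adj, Set.mem_singleton_iff, exists_eq_left, ht]
  constructor
  · rintro ⟨hne, rfl | rfl⟩
    · exact ⟨_, rfl, fun e => hne (by rw [← e]), Or.inl rfl⟩
    · exact ⟨_, rfl, fun e => hne (by rw [← e]), Or.inr (by simp)⟩
  · rintro ⟨z', rfl, hne, h⟩
    refine ⟨fun e => hne (Prod.mk.inj e).2, h.imp (fun h => by rw [h]) fun h => ?_⟩
    rw [← h, Equiv.symm_apply_apply]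

/-- Away from the ends of the lines, two copies of a Schreier graph together with the enumeration
cycle look like a Schreier graph. -/
lemma twoCopies_sup_cyclicNext_adj_iff [NeZero p] {Γ : Type*} [Group Γ]
    {ρ : Γ →* Equiv.Perm (ZMod p × ZMod p)} {S : Set Γ} {i : Bool} {t : Γ}
    (ht : ρ t = lineShift p i) (htS : t ∈ S)
    {z : ZMod p × ZMod p} (hz : lineCoord i z ≠ 0 ∧ lineCoord i z ≠ -1)
    (v : Bool × (ZMod p × ZMod p)) :
    (twoCopies (schreier ρ S) ⊔
      SimpleGraph.fromRel (CyclicNext (snake p) (2 * p ^ 2 - 1))).Adj (i, z) v ↔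
      ∃ z', v = (i, z') ∧ (schreier ρ S).Adj z z' := by
  rw [SimpleGraph.sup_adj, fromRel_cyclicNext_adj_iff ht hz]
  constructor
  · rintro (⟨h, h'⟩ | ⟨z', rfl, h⟩)
    · exact ⟨v.2, Prod.ext h.symm rfl, h'⟩
    · refine ⟨z', rfl, ?_⟩
      simp only [schreier, SimpleGraph.fromRel_adj, Set.mem_singleton_iff, exists_eq_left] at h ⊢
      exact ⟨h.1, h.2.imp (fun h => ⟨t, htS, h⟩) fun h => ⟨t, htS, h⟩⟩
  · rintro ⟨z', rfl, h⟩
    exact Or.inl ⟨rfl, h⟩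

end Snake

section Example

/-- A prime number that is at least `n + 7`. -/
noncomputable def largePrime (n : ℕ) : ℕ := Classical.choose (Nat.exists_infinite_primes (n + 7))

lemma le_largePrime (n : ℕ) : n + 7 ≤ largePrime n :=
  (Classical.choose_spec (Nat.exists_infinite_primes (n + 7))).1

instance fact_prime_largePrime (n : ℕ) : Fact (largePrime n).Prime :=
  ⟨(Classical.choose_spec (Nat.exists_infinite_primes (n + 7))).2⟩

/-- The affine plane over the field with `largePrime n` elements. -/
abbrev Plane (n : ℕ) : Type := ZMod (largePrime n) × ZMod (largePrime n)

lemma ncard_line_le {p : ℕ} [Fact p.Prime] (a b c : ZMod p) (h : ¬ (a = 0 ∧ b = 0 ∧ c = 0)) :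
    {z : ZMod p × ZMod p | a * z.1 + b * z.2 + c = 0}.ncard ≤ p := by
  have key : ∀ φ : ZMod p × ZMod p → ZMod p,
      Set.InjOn φ {z : ZMod p × ZMod p | a * z.1 + b * z.2 + c = 0} →
      {z : ZMod p × ZMod p | a * z.1 + b * z.2 + c = 0}.ncard ≤ p := by
    intro φ hφ
    have := Set.ncard_le_ncard_of_injOn φ (t := Set.univ) (fun _ _ => Set.mem_univ _) hφ
    simpa [Set.ncard_univ, Nat.card_zmod] using this
  by_cases ha : a = 0
  · refine key Prod.fst fun z hz w hw e => ?_
    have hz' : a * z.1 + b * z.2 + c = 0 := hz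
    have hw' : a * w.1 + b * w.2 + c = 0 := hw
    have hb : b ≠ 0 := by
      rintro rfl
      subst ha
      exact h ⟨rfl, rfl, by simpa using hz'⟩
    refine Prod.ext e (mul_left_cancel₀ hb ?_)
    rw [e] at hz'
    linear_combination hz' - hw'
  · refine key Prod.snd fun z hz w hw e => ?_
    have hz' : a * z.1 + b * z.2 + c = 0 := hz
    have hw' : a * w.1 + b * w.2 + c = 0 := hw
    refine Prod.ext (mul_left_cancel₀ ha ?_) e
    rw [e] at hz'
    linear_combination hz' - hw'

lemma eventually_intCast_ne_zero {a : ℤ} (ha : a ≠ 0) :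
    ∀ᶠ n in atTop, (a : ZMod (largePrime n)) ≠ 0 := by
  filter_upwards [eventually_ge_atTop a.natAbs] with n hn h
  rw [ZMod.intCast_zmod_eq_zero_iff_dvd, ← Int.natAbs_dvd_natAbs, Int.natAbs_natCast] at h
  have := Nat.le_of_dvd (Int.natAbs_pos.2 ha) h
  have := le_largePrime n
  omega

lemma negligible_line (a b c : ℤ) (h : ¬ (a = 0 ∧ b = 0 ∧ c = 0)) :
    Negligible fun n => {z : Plane n | (a : ZMod (largePrime n)) * z.1 + b * z.2 + c = 0} := by
  have hne : ∀ᶠ n in atTop, ¬ ((a : ZMod (largePrime n)) = 0 ∧ (b : ZMod (largePrime n)) = 0 ∧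
      (c : ZMod (largePrime n)) = 0) := by
    by_cases ha : a = 0
    · by_cases hb : b = 0
      · exact (eventually_intCast_ne_zero fun hc => h ⟨ha, hb, hc⟩).mono fun n hn h' => hn h'.2.2
      · exact (eventually_intCast_ne_zero hb).mono fun n hn h' => hn h'.2.1
    · exact (eventually_intCast_ne_zero ha).mono fun n hn h' => hn h'.1
  refine squeeze_zero' (Eventually.of_forall fun n => by positivity) ?_
    (tendsto_one_div_add_atTop_nhds_zero_nat (𝕜 := ℝ))
  filter_upwards [hne] with n hn
  have h1 := ncard_line_le _ _ _ hn
  have h2 := le_largePrime n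
  have h3 : Fintype.card (Plane n) = largePrime n * largePrime n := by simp [ZMod.card]
  have hp : 0 < largePrime n := by omega
  rw [h3, div_le_div_iff₀ (by positivity) (by positivity)]
  have h4 : ({z : Plane n | (a : ZMod (largePrime n)) * z.1 + b * z.2 + c = 0}.ncard : ℝ) ≤
    largePrime n := by exact_mod_cast h1
  have h5 : (n : ℝ) + 1 ≤ largePrime n := by exact_mod_cast (by omega)
  push_cast
  nlinarith

/-- The sequences of permutations of the planes given by a common integral affine map of
determinant one. -/
def integralAffine : Subgroup (∀ n, Equiv.Perm (Plane n)) where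
  carrier := {g | ∃ a b c d e f : ℤ, a * d - b * c = 1 ∧
    ∀ n z, g n z = (a * z.1 + b * z.2 + e, c * z.1 + d * z.2 + f)}
  one_mem' := ⟨1, 0, 0, 1, 0, 0, by norm_num, fun n z => by simp⟩
  mul_mem' := by
    rintro g g' ⟨a, b, c, d, e, f, h, hg⟩ ⟨a', b', c', d', e', f', h', hg'⟩
    refine ⟨a * a' + b * c', a * b' + b * d', c * a' + d * c', c * b' + d * d',
      a * e' + b * f' + e, c * e' + d * f' + f, ?_, fun n z => ?_⟩
    · linear_combination (a' * d' - b' * c') * h + h'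
    · rw [Pi.mul_apply, Equiv.Perm.mul_apply, hg', hg]
      ext <;> push_cast <;> ring
  inv_mem' := by
    rintro g ⟨a, b, c, d, e, f, h, hg⟩
    refine ⟨d, -b, -c, a, b * f - d * e, c * e - a * f, by linear_combination h, fun n z => ?_⟩
    have h' : (a : ZMod (largePrime n)) * d - b * c = 1 := by
      exact_mod_cast congrArg (Int.cast : ℤ → ZMod (largePrime n)) h
    rw [Pi.inv_apply, Equiv.Perm.inv_eq_iff_eq, hg]
    ext <;> push_cast
    · linear_combination (e - z.1) * h'
    · linear_combination (f - z.2) * h'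

lemma negligible_fixedPoints {g : ∀ n, Equiv.Perm (Plane n)} (hg : g ∈ integralAffine)
    (h1 : g ≠ 1) : Negligible fun n => {x | g n x = x} := by
  obtain ⟨a, b, c, d, e, f, -, hg⟩ := hg
  by_cases hX : a - 1 = 0 ∧ b = 0 ∧ e = 0
  · have hY : ¬ (c = 0 ∧ d - 1 = 0 ∧ f = 0) := by
      rintro ⟨rfl, hd, rfl⟩
      obtain ⟨ha, rfl, rfl⟩ := hX
      obtain rfl : a = 1 := by omega
      obtain rfl : d = 1 := by omega
      exact h1 (funext fun n => Equiv.ext fun z => by simp [hg])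
    refine (negligible_line c (d - 1) f hY).mono fun n z hz => ?_
    have h2 : g n z = z := hz
    rw [hg] at h2
    have := congrArg Prod.snd h2
    rw [Set.mem_ofPred_eq]
    push_cast
    simp only at this
    linear_combination this
  · refine (negligible_line (a - 1) b e hX).mono fun n z hz => ?_
    have h2 : g n z = z := hz
    rw [hg] at h2
    have := congrArg Prod.fst h2
    rw [Set.mem_ofPred_eq]
    push_cast
    simp only at this
    linear_combination this

/-- Translations and shears of all the planes. -/
def baseGenerators : Set (∀ n, Equiv.Perm (Plane n)) :=
  {fun n => translX (largePrime n), fun n => translY (largePrime n),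
    (fun n => translX (largePrime n)) * fun n => translX (largePrime n),
    fun n => shearU (largePrime n), fun n => shearL (largePrime n)}

lemma translX_mem_integralAffine : (fun n => translX (largePrime n)) ∈ integralAffine :=
  ⟨1, 0, 0, 1, 1, 0, by norm_num, fun n z => by simp [translX]⟩

lemma baseGenerators_subset : baseGenerators ⊆ integralAffine := by
  rintro g (rfl | rfl | rfl | rfl | rfl)
  · exact translX_mem_integralAffine
  · exact ⟨1, 0, 0, 1, 0, 1, by norm_num, fun n z => by simp [translY]⟩
  · exact mul_mem translX_mem_integralAffine translX_mem_integralAffine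
  · exact ⟨1, 1, 0, 1, 0, 0, by norm_num, fun n z => by simp [shearU]⟩
  · exact ⟨1, 0, 1, 1, 0, 0, by norm_num, fun n z => by simp [shearL]⟩

/-- The group generated by the translations and shears. -/
abbrev planeGroup : Subgroup (∀ n, Equiv.Perm (Plane n)) := Subgroup.closure baseGenerators

/-- The generating set of `planeGroup`. -/
def generators : Set planeGroup := Subtype.val ⁻¹' baseGenerators

/-- The action of `planeGroup` on the `n`-th plane. -/
def planeAction (n : ℕ) : planeGroup →* Equiv.Perm (Plane n) :=
  (Pi.evalMonoidHom _ n).comp planeGroup.subtype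

lemma finite_generators : generators.Finite :=
  Set.Finite.preimage Subtype.val_injective.injOn (by unfold baseGenerators; exact Set.toFinite _)

lemma closure_generators : Subgroup.closure generators = ⊤ :=
  Subgroup.closure_closure_coe_preimage

lemma negligible_fixedPoints_planeAction (k : planeGroup) (hk : k ≠ 1) :
    Negligible fun n => {x | planeAction n k x = x} :=
  negligible_fixedPoints ((Subgroup.closure_le _).2 baseGenerators_subset k.2)
    fun h => hk (Subtype.ext h)

lemma natCast_ne_zero_of_lt_seven {k : ℕ} (h0 : k ≠ 0) (hk : k < 7) (n : ℕ) :
    (k : ZMod (largePrime n)) ≠ 0 := by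
  rw [Ne, ZMod.natCast_eq_zero_iff]
  intro h
  have := Nat.le_of_dvd (Nat.pos_of_ne_zero h0) h
  have := le_largePrime n
  omega

/-- The values at the origin of the generators. -/
lemma apply_zero_of_mem_generators {k : planeGroup} (hk : k ∈ generators) (n : ℕ) :
    planeAction n k 0 = (1, 0) ∨ planeAction n k 0 = (0, 1) ∨ planeAction n k 0 = (2, 0) ∨
      (planeAction n k 0 = 0 ∧
        (planeAction n k (1, 1) = (2, 1) ∨ planeAction n k (1, 1) = (1, 2))) := by
  obtain ⟨k, hk'⟩ := k
  rcases hk with h | h | h | h | h <;> simp only at h <;> subst h <;>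
    simp [planeAction, translX, translY, shearU, shearL, one_add_one_eq_two]

lemma one_notMem_generators : (1 : planeGroup) ∉ generators := by
  intro h
  have h1 := natCast_ne_zero_of_lt_seven (k := 1) (by norm_num) (by norm_num) 0
  have h2 := natCast_ne_zero_of_lt_seven (k := 2) (by norm_num) (by norm_num) 0
  push_cast at h1 h2
  have h3 : (1 : ZMod (largePrime 0)) ≠ 2 := fun e => h1 (by linear_combination - e)
  rcases apply_zero_of_mem_generators h 0 with h | h | h | ⟨-, h | h⟩ <;>
    simp [Prod.ext_iff] at h
  · exact h2 h.symm
  · exact h3 h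
  · exact h3 h

/-- The unit translation along the first axis for `false`, along the second one for `true`. -/
noncomputable def axisTranslation (i : Bool) : planeGroup :=
  ⟨fun n => lineShift (largePrime n) i, Subgroup.subset_closure (by
    cases i
    · exact Or.inl rfl
    · exact Or.inr (Or.inl rfl))⟩

lemma axisTranslation_mem (i : Bool) : axisTranslation i ∈ generators := by
  cases i
  · exact Or.inl rfl
  · exact Or.inr (Or.inl rfl)

lemma neighborsAdjacent_axisTranslation_false (z : planeGroup) :
    NeighborsAdjacent (cayley generators) (cayley {axisTranslation false}) z := by
  have hsq : axisTranslation false * axisTranslation false ∈ generators :=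
    Or.inr (Or.inr (Or.inl rfl))
  have key : ∀ u, (cayley {axisTranslation false}).Adj z u →
      u = z * axisTranslation false ∨ u = z * (axisTranslation false)⁻¹ := by
    intro u hu
    rw [cayley, SimpleGraph.fromRel_adj] at hu
    rcases hu.2 with h | h
    · left
      rw [← Set.mem_singleton_iff.1 h]
      group
    · right
      rw [← Set.mem_singleton_iff.1 h]
      group
  intro u v hu hv huv
  rw [cayley, SimpleGraph.fromRel_adj]
  refine ⟨huv, ?_⟩
  rcases key u hu with rfl | rfl <;> rcases key v hv with rfl | rfl
  · exact absurd rfl huv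
  · right
    convert hsq using 1
    group
  · left
    convert hsq using 1
    group
  · exact absurd rfl huv

lemma not_neighborsAdjacent_axisTranslation_true :
    ¬ NeighborsAdjacent (cayley generators) (cayley {axisTranslation true}) 1 := by
  intro h
  have h1 := natCast_ne_zero_of_lt_seven (k := 1) (by norm_num) (by norm_num) 0
  have h2 := natCast_ne_zero_of_lt_seven (k := 2) (by norm_num) (by norm_num) 0
  have h3 := natCast_ne_zero_of_lt_seven (k := 3) (by norm_num) (by norm_num) 0
  push_cast at h1 h2 h3
  set t := axisTranslation true with ht
  have hone : (1 : planeGroup) ∉ ({t} : Set planeGroup) := fun e =>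
    one_notMem_generators (e ▸ axisTranslation_mem true)
  have hu := cayley_adj_mul hone 1 (Set.mem_singleton t)
  have hv := cayley_adj_mul_inv hone 1 (Set.mem_singleton t)
  have hval : planeAction 0 (t * t) 0 = (0, 2) := by
    simp [planeAction, ht, axisTranslation, lineShift, translY, one_add_one_eq_two]
  have hval' : planeAction 0 (t⁻¹ * t⁻¹) 0 = (0, -2) := by
    rw [← mul_inv_rev, map_inv, Equiv.Perm.inv_eq_iff_eq]
    ext
    · simp [planeAction, ht, axisTranslation, lineShift, translY]
    · simp [planeAction, ht, axisTranslation, lineShift, translY]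
      norm_num
  have hne : 1 * t ≠ 1 * t⁻¹ := by
    intro e
    have e' : t * t = 1 := by
      rw [one_mul, one_mul] at e
      nth_rewrite 1 [e]
      simp
    rw [e'] at hval
    simp [Prod.ext_iff] at hval
    exact h2 hval.symm
  have hadj := h _ _ hu hv hne
  rw [cayley, SimpleGraph.fromRel_adj] at hadj
  have hcases : t⁻¹ * t⁻¹ ∈ generators ∨ t * t ∈ generators := by
    simpa using hadj.2
  rcases hcases with hm | hm
  · rcases apply_zero_of_mem_generators hm 0 with h | h | h | ⟨h, -⟩ <;> rw [hval'] at h <;>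
      simp only [Prod.ext_iff, Prod.fst_zero, Prod.snd_zero] at h
    · exact h1 h.1.symm
    · exact h3 (by linear_combination - h.2)
    · exact h2 h.1.symm
    · exact h2 (by linear_combination - h.2)
  · rcases apply_zero_of_mem_generators hm 0 with h | h | h | ⟨h, -⟩ <;> rw [hval] at h <;>
      simp only [Prod.ext_iff, Prod.fst_zero, Prod.snd_zero] at h
    · exact h1 h.1.symm
    · exact h1 (by linear_combination h.2)
    · exact h2 h.1.symm
    · exact h2 h.2

lemma negligible_lineCoord (i : Bool) :
    Negligible fun n => {z : Plane n | lineCoord i z = 0 ∨ lineCoord i z = -1} := by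
  cases i
  · refine ((negligible_line 1 0 0 (by norm_num)).union
      (negligible_line 1 0 1 (by norm_num))).mono fun n z hz => ?_
    rcases hz with h | h
    · left
      simpa [lineCoord] using h
    · right
      simpa [lineCoord, eq_neg_iff_add_eq_zero] using h
  · refine ((negligible_line 0 1 0 (by norm_num)).union
      (negligible_line 0 1 1 (by norm_num))).mono fun n z hz => ?_
    rcases hz with h | h
    · left
      simpa [lineCoord] using h
    · right
      simpa [lineCoord, eq_neg_iff_add_eq_zero] using h

/-- The cycle through two copies of the `n`-th plane. -/
def planeCycle (n : ℕ) : SimpleGraph (Bool × Plane n) :=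
  SimpleGraph.fromRel (CyclicNext (snake (largePrime n)) (2 * largePrime n ^ 2 - 1))

/-- Two copies of the Schreier graph of the `n`-th plane, together with `planeCycle`. -/
def planeHamiltonian (n : ℕ) : SimpleGraph (Bool × Plane n) :=
  twoCopies (schreier (planeAction n) generators) ⊔ planeCycle n

lemma planeCycle_adj_iff (n : ℕ) (i : Bool) (z : Plane n)
    (hz : z ∉ {z : Plane n | lineCoord i z = 0 ∨ lineCoord i z = -1}) (v : Bool × Plane n) :
    (planeCycle n).Adj (i, z) v ↔
      ∃ z', v = (i, z') ∧ (schreier (planeAction n) {axisTranslation i}).Adj z z' :=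
  fromRel_cyclicNext_adj_iff rfl (not_or.1 hz) v

lemma planeHamiltonian_adj_iff (n : ℕ) (i : Bool) (z : Plane n)
    (hz : z ∉ {z : Plane n | lineCoord i z = 0 ∨ lineCoord i z = -1}) (v : Bool × Plane n) :
    (planeHamiltonian n).Adj (i, z) v ↔
      ∃ z', v = (i, z') ∧ (schreier (planeAction n) generators).Adj z z' :=
  twoCopies_sup_cyclicNext_adj_iff rfl (axisTranslation_mem i) (not_or.1 hz) v

lemma exists_hamiltonianCycle_planeHamiltonian (n : ℕ) :
    ∃ c : (planeHamiltonian n).Walk (snake (largePrime n) (2 * largePrime n ^ 2 - 1))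
      (snake (largePrime n) (2 * largePrime n ^ 2 - 1)),
      c.IsHamiltonianCycle ∧ cycleSubgraph (planeHamiltonian n) c = planeCycle n := by
  have h1 : 7 ≤ largePrime n := by have := le_largePrime n; omega
  have h2 : 7 * 7 ≤ largePrime n ^ 2 := by rw [sq]; exact Nat.mul_le_mul h1 h1
  refine exists_hamiltonianCycle (by omega) _ (fun i hi j hj h => snake_injective i hi j hj h) ?_
    le_sup_right
  rw [Fintype.card_prod, Fintype.card_prod, Fintype.card_bool, ZMod.card, ← sq]
  omega

/-- A subgraph of the Schreier graphs cannot asymptotically look like the lines along the first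
axis at half of the points and like the lines along the second axis at the other half. -/
lemma not_tendsto_half {m₀ m₁ : ℕ} {A₀ B₀ : SimpleGraph (Fin m₀)} {w₀ : Fin m₀}
    {A₁ B₁ : SimpleGraph (Fin m₁)} {w₁ : Fin m₁}
    (hα₀ : ColoredBallIso (cayley generators) (cayley {axisTranslation false}) 1 2 A₀ B₀ w₀)
    (hα₁ : ColoredBallIso (cayley generators) (cayley {axisTranslation true}) 1 2 A₁ B₁ w₁)
    {D : ∀ n, SimpleGraph (Plane n)} (hD : ∀ n, D n ≤ schreier (planeAction n) generators)
    (h₀ : Tendsto (fun n => coloredProportion (schreier (planeAction n) generators) (D n)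
      2 m₀ A₀ B₀ w₀) atTop (𝓝 (1 / 2)))
    (h₁ : Tendsto (fun n => coloredProportion (schreier (planeAction n) generators) (D n)
      2 m₁ A₁ B₁ w₁) atTop (𝓝 (1 / 2))) : False := by
  have hlim := (h₀.mul (h₀.const_sub 1)).sub (((h₀.const_sub 1).sub h₁).const_mul 96)
  have hle := le_of_tendsto hlim (b := 0) (Eventually.of_forall fun n => ?_)
  · norm_num at hle
  have key := card_mul_card_compl_le (p := largePrime n)
    {x | ColoredBallIso (schreier (planeAction n) generators) (D n) x 2 A₀ B₀ w₀}
  have hleave := fun {s : planeGroup} (hs : s ∈ generators) =>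
    leaving_le (axisTranslation_mem true) neighborsAdjacent_axisTranslation_false
      not_neighborsAdjacent_axisTranslation_true hα₀ hα₁ (hD n) hs
  have hX := hleave (axisTranslation_mem false)
  have hY := hleave (axisTranslation_mem true)
  have hU := hleave (s := ⟨fun n => shearU (largePrime n), Subgroup.subset_closure
    (Or.inr (Or.inr (Or.inr (Or.inl rfl))))⟩) (Or.inr (Or.inr (Or.inr (Or.inl rfl))))
  have hL := hleave (s := ⟨fun n => shearL (largePrime n), Subgroup.subset_closure
    (Or.inr (Or.inr (Or.inr (Or.inr rfl))))⟩) (Or.inr (Or.inr (Or.inr (Or.inr rfl))))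
  change leaving _ (translX (largePrime n)) ≤ _ at hX
  change leaving _ (translY (largePrime n)) ≤ _ at hY
  change leaving _ (shearU (largePrime n)) ≤ _ at hU
  change leaving _ (shearL (largePrime n)) ≤ _ at hL
  have hcard : (Fintype.card (Plane n) : ℝ) = (largePrime n : ℝ) ^ 2 := by
    rw [Fintype.card_prod, ZMod.card]
    push_cast
    ring
  have hp : (0 : ℝ) < (largePrime n : ℝ) ^ 2 := by
    have := NeZero.pos (largePrime n)
    positivity
  simp only [coloredProportion]
  rw [hcard] at hX hY hU hL ⊢
  change (Nat.card {x // ColoredBallIso (schreier (planeAction n) generators) (D n) x 2 A₀ B₀ w₀} :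
    ℝ) * ((largePrime n : ℝ) ^ 2 - Nat.card {x // ColoredBallIso (schreier (planeAction n)
      generators) (D n) x 2 A₀ B₀ w₀}) ≤ _ at key
  generalize leaving _ (translX (largePrime n)) = lX at *
  generalize leaving _ (translY (largePrime n)) = lY at *
  generalize leaving _ (shearU (largePrime n)) = lU at *
  generalize leaving _ (shearL (largePrime n)) = lL at *
  generalize (Nat.card {x // ColoredBallIso (schreier (planeAction n) generators) (D n) x
    2 A₀ B₀ w₀} : ℝ) = a at *
  generalize (Nat.card {x // ColoredBallIso (schreier (planeAction n) generators) (D n) x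
    2 A₁ B₁ w₁} : ℝ) = b at *
  generalize (largePrime n : ℝ) ^ 2 = q at *
  have h2 : a * (q - a) ≤ 96 * q * (q - a - b) := by
    nlinarith [mul_le_mul_of_nonneg_left (add_le_add (add_le_add hX hY) (add_le_add hU hL)) hp.le]
  have h3 : a / q * (1 - a / q) - 96 * (1 - a / q - b / q) =
      (a * (q - a) - 96 * q * (q - a - b)) / q ^ 2 := by
    field_simp
  rw [h3]
  exact div_nonpos_of_nonpos_of_nonneg (by linarith) (by positivity)

/-- No colored ball type of radius two occurs at the identity for both axes. -/
lemma not_coloredBallIso_both {m : ℕ} {A B : SimpleGraph (Fin m)} {w : Fin m}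
    (h₀ : ColoredBallIso (cayley generators) (cayley {axisTranslation false}) 1 2 A B w)
    (h₁ : ColoredBallIso (cayley generators) (cayley {axisTranslation true}) 1 2 A B w) :
    False := by
  have hle : cayley {axisTranslation true} ≤ cayley generators := by
    have hsub : {axisTranslation true} ⊆ generators :=
      Set.singleton_subset_iff.2 (axisTranslation_mem true)
    intro x y h
    rw [cayley, SimpleGraph.fromRel_adj] at h ⊢
    exact ⟨h.1, h.2.imp (fun e => hsub e) fun e => hsub e⟩
  obtain ⟨z, -, hz⟩ := (h₁.coloredIso h₀).exists_neighborsAdjacent hle (self_mem_ballSet _ 1 1)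
  exact not_neighborsAdjacent_axisTranslation_true
    (hz (neighborsAdjacent_axisTranslation_false z))

end Example

/-- There exist a group `Γ` with a finite generating set `S`
(with `1 ∉ S`) with Cayley graph `G = Cay(Γ, S)`, and sequences `(G n)` and
`(K n)` of finite graphs, both Benjamini–Schramm converging to `G`, such that:
each `K n` contains a Hamiltonian cycle `c n`; the sequence of pairs
`(K n, c n)` locally converges (for every `r` and every rooted edge-2-colored
finite graph `α`, the proportion `p_r(α; K n, c n)` converges as `n → ∞`); and
yet for every choice of subgraphs `D n ≤ G n`, the sequence of pairs
`(G n, D n)` does not converge to the same limit as `(K n, c n)`: there are `r`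
and a rooted edge-2-colored finite graph `α` such that `p_r(α; G n, D n)` does
not converge to `lim_n p_r(α; K n, c n)`. -/
theorem stmt_1 : ∃ (Γ : Type) (_ : Group Γ) (S : Set Γ)
    (VG : ℕ → Type) (_ : ∀ n, Fintype (VG n)) (G : ∀ n, SimpleGraph (VG n))
    (VK : ℕ → Type) (_ : ∀ n, Fintype (VK n)) (_ : ∀ n, DecidableEq (VK n))
    (K : ∀ n, SimpleGraph (VK n))
    (v : ∀ n, VK n) (c : ∀ n, (K n).Walk (v n) (v n)),
    S.Finite ∧ (1 : Γ) ∉ S ∧ Subgroup.closure S = ⊤ ∧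
    BSLimit G (cayley S) 1 ∧
    BSLimit K (cayley S) 1 ∧
    (∀ n, (c n).IsHamiltonianCycle) ∧
    (∀ (r m : ℕ) (A B : SimpleGraph (Fin m)) (w : Fin m), ∃ L : ℝ,
      Tendsto (fun n => coloredProportion (K n) (cycleSubgraph (K n) (c n)) r m A B w)
        atTop (𝓝 L)) ∧
    (∀ D : ∀ n, SimpleGraph (VG n), (∀ n, D n ≤ G n) →
      ∃ (r m : ℕ) (A B : SimpleGraph (Fin m)) (w : Fin m) (L : ℝ),
        Tendsto (fun n => coloredProportion (K n) (cycleSubgraph (K n) (c n)) r m A B w)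
          atTop (𝓝 L) ∧
        ¬ Tendsto (fun n => coloredProportion (G n) (D n) r m A B w) atTop (𝓝 L)) := by
  choose c hc hcG using exists_hamiltonianCycle_planeHamiltonian
  have hlim := tendsto_coloredProportion finite_generators one_notMem_generators
    negligible_fixedPoints_planeAction axisTranslation_mem negligible_lineCoord
    planeHamiltonian_adj_iff planeCycle_adj_iff
  refine ⟨planeGroup, inferInstance, generators, Plane, inferInstance,
    fun n => schreier (planeAction n) generators, fun n => Bool × Plane n, inferInstance,
    inferInstance, planeHamiltonian, _, c, finite_generators, one_notMem_generators,
    closure_generators, bsLimit_schreier finite_generators one_notMem_generators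
      negligible_fixedPoints_planeAction,
    bsLimit_of_local_model finite_generators one_notMem_generators
      negligible_fixedPoints_planeAction negligible_lineCoord planeHamiltonian_adj_iff,
    hc, fun r m A B w => ⟨_, by simpa only [hcG] using hlim r m A B w⟩, fun D hD => ?_⟩
  by_contra! hcon
  simp only [hcG] at hcon
  obtain ⟨m₀, A₀, B₀, w₀, hα₀⟩ := exists_coloredBallIso_of_finite (cayley generators)
    (cayley {axisTranslation false}) 1 2 (finite_ballSet_cayley finite_generators _ _)
  obtain ⟨m₁, A₁, B₁, w₁, hα₁⟩ := exists_coloredBallIso_of_finite (cayley generators)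
    (cayley {axisTranslation true}) 1 2 (finite_ballSet_cayley finite_generators _ _)
  have h₀ := hcon 2 m₀ A₀ B₀ w₀ _ (hlim 2 m₀ A₀ B₀ w₀)
  have h₁ := hcon 2 m₁ A₁ B₁ w₁ _ (hlim 2 m₁ A₁ B₁ w₁)
  rw [if_pos hα₀, if_neg fun h => not_coloredBallIso_both hα₀ h, add_zero] at h₀
  rw [if_neg fun h => not_coloredBallIso_both h hα₁, if_pos hα₁, zero_add] at h₁
  exact not_tendsto_half hα₀ hα₁ hD h₀ h₁
end

section
/- Let Γ = ⟨a,b,c,d | b², c², d², cdcd, ada⁻¹c, aca⁻¹d, bcbd⟩ and let F = ℤ * (ℤ/2ℤ). The assignment a ↦ a, b ↦ b, c ↦ 1, d ↦ 1 induces a well-defined surjective group homomorphism φ : Γ → F, whose kernel is the subgroup of Γ generated by (the images of) c and d, and this kernel is isomorphic to the Klein four-group (ℤ/2ℤ) × (ℤ/2ℤ). -/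
/-- The free product `F = ℤ * (ℤ/2ℤ)`. -/
abbrev F : Type := Monoid.Coprod (Multiplicative ℤ) (Multiplicative (ZMod 2))

/-- The image in `F` of a generator of `ℤ`. -/
def aF : F := Monoid.Coprod.inl (Multiplicative.ofAdd (1 : ℤ))

/-- The image in `F` of the generator of `ℤ/2ℤ`. -/
def bF : F := Monoid.Coprod.inr (Multiplicative.ofAdd (1 : ZMod 2))

/-- The free-group letters `a, b, c, d`. -/
private def fa : FreeGroup (Fin 4) := FreeGroup.of 0
private def fb : FreeGroup (Fin 4) := FreeGroup.of 1
private def fc : FreeGroup (Fin 4) := FreeGroup.of 2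
private def fd : FreeGroup (Fin 4) := FreeGroup.of 3

/-- The relators `b², c², d², cdcd, ada⁻¹c, aca⁻¹d, bcbd`. -/
def rels : Set (FreeGroup (Fin 4)) :=
  {fb ^ 2, fc ^ 2, fd ^ 2, fc * fd * fc * fd, fa * fd * fa⁻¹ * fc,
    fa * fc * fa⁻¹ * fd, fb * fc * fb * fd}

/-- The group `Γ = ⟨a,b,c,d | b², c², d², cdcd, ada⁻¹c, aca⁻¹d, bcbd⟩`. -/
abbrev Γp : Type := PresentedGroup rels

/-- The images of the generating symbols `a, b, c, d` in `Γ`. -/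
def ga : Γp := PresentedGroup.of 0
def gb : Γp := PresentedGroup.of 1
def gc : Γp := PresentedGroup.of 2
def gd : Γp := PresentedGroup.of 3

theorem zmultiplesHom_two {G : Type*} [Group G] (g : G) (hg : g ^ 2 = 1) :
    zmultiplesHom (Additive G) (Additive.ofMul g) (2 : ℕ) = 0 := by
  rw [zmultiplesHom_apply, natCast_zsmul, ← ofMul_pow, hg, ofMul_one]

/-- The homomorphism from `ℤ/2ℤ` determined by an element squaring to one. -/
def involutionHom {G : Type*} [Group G] (g : G) (hg : g ^ 2 = 1) :
    Multiplicative (ZMod 2) →* G :=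
  AddMonoidHom.toMultiplicativeLeft
    (ZMod.lift 2 ⟨zmultiplesHom (Additive G) (Additive.ofMul g), zmultiplesHom_two g hg⟩)

theorem involutionHom_one {G : Type*} [Group G] (g : G) (hg : g ^ 2 = 1) :
    involutionHom g hg (Multiplicative.ofAdd 1) = g := by
  have h := ZMod.lift_coe 2
    ⟨zmultiplesHom (Additive G) (Additive.ofMul g), zmultiplesHom_two g hg⟩ 1
  simp only [Int.cast_one] at h
  simp [involutionHom, h]

theorem zmod_two_eq (x : Multiplicative (ZMod 2)) : x = 1 ∨ x = Multiplicative.ofAdd 1 := by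
  revert x
  decide

theorem bF_sq : bF ^ 2 = 1 := by
  rw [bF, ← map_pow, show (Multiplicative.ofAdd (1 : ZMod 2)) ^ 2 = 1 by decide, map_one]

/-- The projection of `Γ` onto `F` killing `c` and `d`. -/
def projF : Γp →* F :=
  PresentedGroup.toGroup (f := ![aF, bF, 1, 1]) (by
    simp [rels, fa, fb, fc, fd, bF_sq, ← pow_two])

/-- The images of the generators under a permutation representation faithful on `⟨c, d⟩`. -/
def permGen : Fin 4 → Equiv.Perm (Fin 4) :=
  ![Equiv.swap 0 2 * Equiv.swap 1 3, Equiv.swap 0 2 * Equiv.swap 1 3, Equiv.swap 0 1,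
    Equiv.swap 2 3]

/-- The permutation representation of `Γ` given by `permGen`. -/
def permRep : Γp →* Equiv.Perm (Fin 4) :=
  PresentedGroup.toGroup (f := permGen) (by
    simp only [rels, Set.mem_insert_iff, Set.mem_singleton_iff, forall_eq_or_imp, forall_eq,
      fa, fb, fc, fd, map_mul, map_pow, map_inv, FreeGroup.lift_apply_of]
    decide)

theorem gb_sq : gb ^ 2 = 1 :=
  PresentedGroup.one_of_mem (rels := rels) (x := fb ^ 2) (by simp [rels])

theorem gc_sq : gc ^ 2 = 1 :=
  PresentedGroup.one_of_mem (rels := rels) (x := fc ^ 2) (by simp [rels])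

theorem gd_sq : gd ^ 2 = 1 :=
  PresentedGroup.one_of_mem (rels := rels) (x := fd ^ 2) (by simp [rels])

theorem gc_inv : gc⁻¹ = gc := inv_eq_of_mul_eq_one_left (by rw [← pow_two, gc_sq])

theorem gd_inv : gd⁻¹ = gd := inv_eq_of_mul_eq_one_left (by rw [← pow_two, gd_sq])

theorem gb_inv : gb⁻¹ = gb := inv_eq_of_mul_eq_one_left (by rw [← pow_two, gb_sq])

theorem gc_mul_gd : gc * gd = gd * gc := by
  have h : gc * gd * gc * gd = 1 :=
    PresentedGroup.one_of_mem (rels := rels) (x := fc * fd * fc * fd) (by simp [rels])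
  rw [mul_assoc] at h
  simpa [gc_inv, gd_inv] using eq_inv_of_mul_eq_one_left h

theorem ga_conj_gd : ga * gd * ga⁻¹ = gc := by
  have h : ga * gd * ga⁻¹ * gc = 1 :=
    PresentedGroup.one_of_mem (rels := rels) (x := fa * fd * fa⁻¹ * fc) (by simp [rels])
  rw [eq_inv_of_mul_eq_one_left h, gc_inv]

theorem ga_conj_gc : ga * gc * ga⁻¹ = gd := by
  have h : ga * gc * ga⁻¹ * gd = 1 :=
    PresentedGroup.one_of_mem (rels := rels) (x := fa * fc * fa⁻¹ * fd) (by simp [rels])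
  rw [eq_inv_of_mul_eq_one_left h, gd_inv]

theorem gb_conj_gc : gb * gc * gb⁻¹ = gd := by
  have h : gb * gc * gb * gd = 1 :=
    PresentedGroup.one_of_mem (rels := rels) (x := fb * fc * fb * fd) (by simp [rels])
  rw [gb_inv, eq_inv_of_mul_eq_one_left h, gd_inv]

theorem gb_conj_gd : gb * gd * gb⁻¹ = gc := by
  rw [← gb_conj_gc, gb_inv]
  simp only [mul_assoc, ← pow_two, gb_sq, mul_one]
  rw [← mul_assoc, ← pow_two, gb_sq, one_mul]

theorem closure_gens : Subgroup.closure ({ga, gb, gc, gd} : Set Γp) = ⊤ := by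
  rw [← PresentedGroup.closure_range_of rels]
  congr 1
  ext x
  simp [Fin.exists_fin_succ, ga, gb, gc, gd, eq_comm]

instance closure_gc_gd_normal : (Subgroup.closure ({gc, gd} : Set Γp)).Normal := by
  rw [← Subgroup.normalizer_eq_top_iff, eq_top_iff, ← closure_gens, Subgroup.closure_le]
  rintro x (rfl | rfl | rfl | rfl)
  · rw [SetLike.mem_coe, Subgroup.mem_normalizer_iff_map_conj_eq, MonoidHom.map_closure]
    simp [Set.image_pair, ga_conj_gc, ga_conj_gd, Set.pair_comm]
  · rw [SetLike.mem_coe, Subgroup.mem_normalizer_iff_map_conj_eq, MonoidHom.map_closure]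
    simp [Set.image_pair, gb_conj_gc, gb_conj_gd, Set.pair_comm]
  · exact Subgroup.le_normalizer (Subgroup.subset_closure (by simp))
  · exact Subgroup.le_normalizer (Subgroup.subset_closure (by simp))

/-- The section of `projF` sending `a` to `a` and `b` to `b`. -/
def sectionF : F →* Γp :=
  Monoid.Coprod.lift (zpowersHom Γp ga) (involutionHom gb gb_sq)

theorem sectionF_aF : sectionF aF = ga := by simp [sectionF, aF]

theorem sectionF_bF : sectionF bF = gb := by simp [sectionF, bF, involutionHom_one]

theorem projF_ga : projF ga = aF := PresentedGroup.toGroup.of _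

theorem projF_gb : projF gb = bF := PresentedGroup.toGroup.of _

theorem projF_gc : projF gc = 1 := PresentedGroup.toGroup.of _

theorem projF_gd : projF gd = 1 := PresentedGroup.toGroup.of _

theorem projF_comp_sectionF : projF.comp sectionF = MonoidHom.id F := by
  refine Monoid.Coprod.hom_ext (MonoidHom.ext_mint ?_) (MonoidHom.ext fun x => ?_)
  · change projF (sectionF aF) = aF
    rw [sectionF_aF, projF_ga]
  · rcases zmod_two_eq x with rfl | rfl
    · simp
    · change projF (sectionF bF) = bF
      rw [sectionF_bF, projF_gb]

theorem ker_projF : projF.ker = Subgroup.closure {gc, gd} := by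
  apply le_antisymm
  · intro g hg
    have h : (QuotientGroup.mk' (Subgroup.closure ({gc, gd} : Set Γp))).comp
        (sectionF.comp projF) = QuotientGroup.mk' _ := by
      refine MonoidHom.eq_of_eqOn_dense closure_gens ?_
      have hc : gc ∈ Subgroup.closure ({gc, gd} : Set Γp) := Subgroup.subset_closure (by simp)
      have hd : gd ∈ Subgroup.closure ({gc, gd} : Set Γp) := Subgroup.subset_closure (by simp)
      rintro x (rfl | rfl | rfl | rfl)
      · simp [projF_ga, sectionF_aF]
      · simp [projF_gb, sectionF_bF]
      · simp [projF_gc, (QuotientGroup.eq_one_iff _).2 hc]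
      · simp [projF_gd, (QuotientGroup.eq_one_iff _).2 hd]
    have hg' := DFunLike.congr_fun h g
    rw [MonoidHom.comp_apply, MonoidHom.comp_apply, MonoidHom.mem_ker.1 hg, map_one, map_one] at hg'
    exact (QuotientGroup.eq_one_iff g).1 hg'.symm
  · rw [Subgroup.closure_le]
    rintro x (rfl | rfl)
    · exact projF_gc
    · exact projF_gd

/-- The homomorphism from the Klein four-group to `Γ` with image `⟨c, d⟩`. -/
def kleinHom : Multiplicative (ZMod 2) × Multiplicative (ZMod 2) →* Γp :=
  (involutionHom gc gc_sq).noncommCoprod (involutionHom gd gd_sq) fun x y => by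
    rcases zmod_two_eq x with rfl | rfl <;> rcases zmod_two_eq y with rfl | rfl <;>
      simp [involutionHom_one, Commute, SemiconjBy, gc_mul_gd]

theorem kleinHom_injective : Function.Injective kleinHom := by
  have hc : permRep gc = Equiv.swap 0 1 := PresentedGroup.toGroup.of _
  have hd : permRep gd = Equiv.swap 2 3 := PresentedGroup.toGroup.of _
  rw [injective_iff_map_eq_one]
  rintro ⟨x, y⟩ h
  have h' := congrArg permRep h
  rcases zmod_two_eq x with rfl | rfl <;> rcases zmod_two_eq y with rfl | rfl <;>
    simp only [kleinHom, MonoidHom.noncommCoprod_apply, involutionHom_one, map_mul, map_one,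
      hc, hd] at h' ⊢
  · rfl
  all_goals exact absurd h' (by decide)

theorem range_kleinHom : kleinHom.range = Subgroup.closure {gc, gd} := by
  apply le_antisymm
  · rintro _ ⟨⟨x, y⟩, rfl⟩
    have hc : gc ∈ Subgroup.closure ({gc, gd} : Set Γp) := Subgroup.subset_closure (by simp)
    have hd : gd ∈ Subgroup.closure ({gc, gd} : Set Γp) := Subgroup.subset_closure (by simp)
    rcases zmod_two_eq x with rfl | rfl <;> rcases zmod_two_eq y with rfl | rfl <;>
      simp [kleinHom, involutionHom_one, hc, hd, mul_mem]
  · rw [Subgroup.closure_le]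
    rintro x (rfl | rfl)
    · exact ⟨(Multiplicative.ofAdd 1, 1), by simp [kleinHom, involutionHom_one]⟩
    · exact ⟨(1, Multiplicative.ofAdd 1), by simp [kleinHom, involutionHom_one]⟩


/-- The assignment `a ↦ a, b ↦ b, c ↦ 1, d ↦ 1` induces a
well-defined surjective group homomorphism `φ : Γ → F` whose kernel is the
subgroup of `Γ` generated by (the images of) `c` and `d`, and this kernel is
isomorphic to the Klein four-group `(ℤ/2ℤ) × (ℤ/2ℤ)`. -/
theorem stmt_4 : ∃ φ : Γp →* F,
    φ ga = aF ∧ φ gb = bF ∧ φ gc = 1 ∧ φ gd = 1 ∧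
    Function.Surjective φ ∧
    φ.ker = Subgroup.closure {gc, gd} ∧
    Nonempty (φ.ker ≃* Multiplicative (ZMod 2) × Multiplicative (ZMod 2)) := by
  refine ⟨projF, projF_ga, projF_gb, projF_gc, projF_gd, fun x =>
    ⟨sectionF x, DFunLike.congr_fun projF_comp_sectionF x⟩, ker_projF, ⟨?_⟩⟩
  exact (MulEquiv.subgroupCongr (ker_projF.trans range_kleinHom.symm)).trans
    (MonoidHom.ofInjective kleinHom_injective).symm
end
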